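/- Suppose f, a : (0,∞) → ℝ are smooth, f is bounded with f(r) → 1 as r → ∞, 1-a and f' decay exponentially, and define the 4×4 matrix potential V_m^{(n)}(r) (the potential of the m-th block of the linearized operator around the n-vortex) with b = n(1-a)/r. Then V_m^{(n)}(r) → diag(λ, 1, 1, 1) as r → ∞, and consequently the essential spectrum of L_m^{(n)} = -Δ_r·Id + V_m^{(n)} on L²((0,∞), r dr)⁴ equals [min(1, λ), ∞). -/

import Mathlib

open Set MeasureTheory Filter

/-- The measure `r dr` on `(0,∞)`. -/
noncomputable def rmeasure : Measure ℝ :=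
  (volume.restrict (Set.Ioi (0:ℝ))).withDensity fun r => ENNReal.ofReal r

/-- The 4×4 matrix potential `V_m^{(n)}(r)` of the `m`-th block of the linearized
operator around the `n`-vortex, with `b = n(1-a)/r`. -/
noncomputable def Vmn (n m : ℤ) (lam : ℝ) (f a : ℝ → ℝ) (r : ℝ) :
    Matrix (Fin 4) (Fin 4) ℝ :=
  !![(m:ℝ)^2/r^2 + ((n:ℝ)*(1-a r)/r)^2 + lam/2*(3*(f r)^2 - 1),
       -2*(abs (m:ℝ))*((n:ℝ)*(1-a r)/r)/r, -2*((n:ℝ)*(1-a r)/r)*(f r), 0;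
     -2*(abs (m:ℝ))*((n:ℝ)*(1-a r)/r)/r,
       (m:ℝ)^2/r^2 + ((n:ℝ)*(1-a r)/r)^2 + lam/2*((f r)^2 - 1) + (f r)^2, 0,
       -2*(deriv f r);
     -2*((n:ℝ)*(1-a r)/r)*(f r), 0, ((m:ℝ)^2+1)/r^2 + (f r)^2, -2*(abs (m:ℝ))/r^2;
     0, -2*(deriv f r), -2*(abs (m:ℝ))/r^2, ((m:ℝ)^2+1)/r^2 + (f r)^2]

/-- The block operator `L_m^{(n)} = -Δ_r·Id + V_m^{(n)}` acting on vector-valued radial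
functions. -/
noncomputable def Lmn (n m : ℤ) (lam : ℝ) (f a : ℝ → ℝ)
    (u : ℝ → Fin 4 → ℝ) (r : ℝ) (k : Fin 4) : ℝ :=
  -(deriv (deriv (fun s => u s k)) r) - deriv (fun s => u s k) r / r
    + ∑ j, Vmn n m lam f a r k j * u r j

/-- The essential (Weyl) spectrum of a radial block operator: `μ` belongs to it iff there
is an orthonormal singular (Weyl) sequence of smooth functions compactly supported in
`(0,∞)` with `‖(L-μ)u_j‖_{L²(r dr)} → 0`. -/
noncomputable def essSpecRad (L : (ℝ → Fin 4 → ℝ) → ℝ → Fin 4 → ℝ) : Set ℝ :=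
  {μ : ℝ | ∃ u : ℕ → ℝ → Fin 4 → ℝ,
    (∀ j, ContDiff ℝ (⊤ : ℕ∞) (u j)) ∧
    (∀ j, HasCompactSupport (u j)) ∧
    (∀ j, tsupport (u j) ⊆ Set.Ioi 0) ∧
    (∀ i j, (∫ r, (∑ k, u i r k * u j r k) ∂rmeasure)
      = if i = j then (1:ℝ) else 0) ∧
    Tendsto (fun j => ∫ r, (∑ k, (L (u j) r k - μ * u j r k)^2) ∂rmeasure)
      atTop (nhds 0)}

lemma integral_rmeasure (g : ℝ → ℝ) :
    ∫ r, g r ∂rmeasure = ∫ r in Ioi (0:ℝ), r * g r := by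
  unfold rmeasure
  rw [integral_withDensity_eq_integral_toReal_smul (by fun_prop)
    (ae_of_all _ fun _ => ENNReal.ofReal_lt_top)]
  refine setIntegral_congr_fun measurableSet_Ioi fun r hr => ?_
  simp [ENNReal.toReal_ofReal (le_of_lt hr)]

/-- Smooth vector-valued functions with compact support in `(0,∞)`. -/
structure IsTest (u : ℝ → Fin 4 → ℝ) : Prop where
  smooth : ContDiff ℝ (⊤ : ℕ∞) u
  compact : HasCompactSupport u
  supp : tsupport u ⊆ Ioi 0

namespace IsTest

variable {u : ℝ → Fin 4 → ℝ}

lemma comp (h : IsTest u) (k : Fin 4) : ContDiff ℝ (⊤ : ℕ∞) (fun s => u s k) :=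
  contDiff_pi.1 h.smooth k

lemma deriv_comp (h : IsTest u) (k : Fin 4) :
    ContDiff ℝ (⊤ : ℕ∞) (deriv fun s => u s k) := by
  have := h.comp k
  exact (contDiff_infty_iff_deriv.1 this).2

lemma continuous_comp (h : IsTest u) (k : Fin 4) : Continuous (fun s => u s k) :=
  (h.comp k).continuous

lemma continuous_deriv (h : IsTest u) (k : Fin 4) : Continuous (deriv fun s => u s k) :=
  (h.deriv_comp k).continuous

lemma continuous_deriv2 (h : IsTest u) (k : Fin 4) :
    Continuous (deriv (deriv fun s => u s k)) :=
  ((contDiff_infty_iff_deriv.1 (h.deriv_comp k)).2).continuous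

lemma hasDerivAt (h : IsTest u) (k : Fin 4) (r : ℝ) :
    HasDerivAt (fun s => u s k) (deriv (fun s => u s k) r) r :=
  ((h.comp k).differentiable (by simp) r).hasDerivAt

lemma hasDerivAt2 (h : IsTest u) (k : Fin 4) (r : ℝ) :
    HasDerivAt (deriv fun s => u s k) (deriv (deriv fun s => u s k) r) r :=
  ((h.deriv_comp k).differentiable (by simp) r).hasDerivAt

lemma eventually_zero {r : ℝ} (hr : r ∉ tsupport u) (k : Fin 4) :
    (fun s => u s k) =ᶠ[nhds r] fun _ => 0 := by
  filter_upwards [notMem_tsupport_iff_eventuallyEq.1 hr] with s hs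
  simp [hs]

lemma zero {r : ℝ} (hr : r ∉ tsupport u) (k : Fin 4) : u r k = 0 :=
  (eventually_zero hr k).eq_of_nhds

lemma deriv_zero {r : ℝ} (hr : r ∉ tsupport u) (k : Fin 4) :
    deriv (fun s => u s k) r = 0 := by
  rw [(eventually_zero hr k).deriv_eq]; simp

lemma deriv2_zero {r : ℝ} (hr : r ∉ tsupport u) (k : Fin 4) :
    deriv (deriv fun s => u s k) r = 0 := by
  rw [(eventually_zero hr k).deriv.deriv_eq]; simp

lemma integrableOn (h : IsTest u) {F : ℝ → ℝ} (hF : ContinuousOn F (Ioi 0))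
    (h0 : ∀ r, r ∉ tsupport u → F r = 0) : IntegrableOn F (Ioi 0) :=
  ((hF.mono h.supp).integrableOn_compact h.compact).of_forall_sdiff_eq_zero
    measurableSet_Ioi fun x hx => h0 x hx.2

/-- Fundamental theorem of calculus for functions supported inside the support of `u`. -/
lemma integral_deriv (h : IsTest u) {P P' : ℝ → ℝ}
    (hP : ∀ r ∈ Ioi (0:ℝ), HasDerivAt P (P' r) r) (hP' : ContinuousOn P' (Ioi 0))
    (h0 : ∀ r, r ∉ tsupport u → P r = 0) (h0' : ∀ r, r ∉ tsupport u → P' r = 0)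
    {R : ℝ} (hR : 0 ≤ R) :
    ∫ r in Ioi R, P' r = - P R := by
  have hP2 : ∀ r, HasDerivAt P (P' r) r := by
    intro r
    by_cases hr : r ∈ tsupport u
    · exact hP r (h.supp hr)
    · rw [h0' r hr]
      refine (hasDerivAt_const r (0:ℝ)).congr_of_eventuallyEq ?_
      filter_upwards [(isClosed_tsupport u).isOpen_compl.mem_nhds hr] with s hs
      exact h0 s hs
  have hInt : IntegrableOn P' (Ioi R) :=
    (h.integrableOn hP' h0').mono_set (Ioi_subset_Ioi hR)
  have hlim : Tendsto P atTop (nhds 0) := by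
    obtain ⟨B, hB⟩ := h.compact.isCompact.bddAbove
    refine tendsto_const_nhds.congr' ?_
    filter_upwards [eventually_gt_atTop B] with r hr
    exact (h0 r fun hm => absurd (hB hm) (not_le.2 hr)).symm
  have := integral_Ioi_of_hasDerivAt_of_tendsto (hP2 R).continuousAt.continuousWithinAt
    (fun x _ => hP2 x) hInt hlim
  simpa using this

end IsTest

lemma quadratic_lower_bound {M lam b r F F' C x y z w : ℝ} (hM : 0 ≤ M) (hlam : 0 < lam)
    (hr : 0 < r) (hF : |F| ≤ C) :
    (M^2/r^2 + b^2) * (x^2+y^2) - 4*(M*b/r)*x*y + lam/2*(3*F^2-1)*x^2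
      + (lam/2*(F^2-1)+F^2)*y^2 - 4*b*F*x*z - 4*F'*y*w + ((M^2+1)/r^2+F^2)*(z^2+w^2)
      - 4*M/r^2*z*w
    ≥ -(lam/2+4*C^2)*(x^2+y^2+z^2+w^2) - 2*C*M*(x^2+y^2+z^2+w^2)/r - 4*F'*y*w := by
  have hC : 0 ≤ C := (abs_nonneg F).trans hF
  have hF2 : F^2 ≤ C^2 := by
    rw [← sq_abs F]; exact pow_le_pow_left₀ (abs_nonneg F) hF 2
  obtain ⟨s, hs⟩ : ∃ s, s = M / r := ⟨_, rfl⟩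
  have hs0 : 0 ≤ s := hs ▸ by positivity
  obtain ⟨t, ht⟩ : ∃ t, t = 1 / r := ⟨_, rfl⟩
  have e1 : M^2/r^2 = s^2 := by rw [hs]; ring
  have e2 : M*b/r = s*b := by rw [hs]; ring
  have e3 : (M^2+1)/r^2 = s^2+t^2 := by rw [hs, ht]; ring
  have e4 : 4*M/r^2 = 4*(s*t) := by rw [hs, ht]; ring
  have e5 : 2*C*M*(x^2+y^2+z^2+w^2)/r = 2*C*s*(x^2+y^2+z^2+w^2) := by rw [hs]; ring
  rw [e1, e2, e3, e4, e5]
  have k1 : 0 ≤ (s^2+t^2)*(z^2+w^2) - 4*(s*t)*z*w := by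
    nlinarith [sq_nonneg (s*z-t*w), sq_nonneg (s*w-t*z)]
  have k2 : (s^2+b^2)*(x^2+y^2) - 4*(s*b)*x*y ≥ (|b|-s)^2*(x^2+y^2) := by
    have hb : b * (x*y) ≤ |b| * (|x| * |y|) := by
      rw [← abs_mul, ← abs_mul]; exact le_abs_self _
    have : 2*(|x| * |y|) ≤ x^2+y^2 := by
      have h := two_mul_le_add_sq |x| |y|
      rw [sq_abs, sq_abs] at h
      linarith
    have h3 : 0 ≤ s*(|b| * (x^2+y^2-2*(|x| * |y|))) :=
      mul_nonneg hs0 (mul_nonneg (abs_nonneg b) (by linarith))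
    have h4 := mul_le_mul_of_nonneg_left hb hs0
    have e : (|b|-s)^2 = b^2 - 2*(s * |b|) + s^2 := by rw [← sq_abs b]; ring
    rw [e]
    linarith
  have k3 : 4*b*F*x*z ≤ (|b|-s)^2*x^2 + 4*C^2*z^2 + 2*C*s*(x^2+z^2) := by
    have h1 : 4*b*F*x*z ≤ 4*(|b| * (|F| * (|x| * |z|))) := by
      rw [← abs_mul, ← abs_mul, ← abs_mul]
      linarith [le_abs_self (b*(F*(x*z)))]
    have h2 : |b| * (|F| * (|x| * |z|)) ≤ |b| * (C*(|x| * |z|)) := by gcongr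
    have h3 : 4*((|b|-s)*(C*(|x| * |z|))) ≤ (|b|-s)^2*x^2 + 4*C^2*z^2 := by
      have h := sq_nonneg ((|b|-s) * |x| - 2*C * |z|)
      have e : ((|b|-s) * |x| - 2*C * |z|)^2
          = (|b|-s)^2*x^2 + 4*C^2*z^2 - 4*((|b|-s)*(C*(|x| * |z|))) := by
        rw [← sq_abs x, ← sq_abs z]; ring
      linarith
    have h4 : 2*(|x| * |z|) ≤ x^2+z^2 := by
      have h := two_mul_le_add_sq |x| |z|
      rw [sq_abs, sq_abs] at h
      linarith
    have h5 := mul_le_mul_of_nonneg_left h4 (mul_nonneg hC hs0)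
    linarith
  have k4 : 0 ≤ lam * F^2 := by positivity
  have k5 := mul_nonneg (sq_nonneg (|b|-s)) (sq_nonneg y)
  have k6 := mul_nonneg (mul_nonneg hC hs0) (add_nonneg (sq_nonneg y) (sq_nonneg w))
  have k7 := mul_nonneg (sq_nonneg C) (sq_nonneg w)
  have k8 := mul_nonneg (sq_nonneg C) (sq_nonneg x)
  have k9 := mul_nonneg (sq_nonneg C) (sq_nonneg y)
  have l1 := mul_nonneg k4 (sq_nonneg x)
  have l2 := mul_nonneg k4 (sq_nonneg y)
  have l3 := mul_nonneg (sq_nonneg F) (sq_nonneg y)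
  have l4 := mul_nonneg (sq_nonneg F) (add_nonneg (sq_nonneg z) (sq_nonneg w))
  have l5 := mul_nonneg hlam.le (add_nonneg (sq_nonneg z) (sq_nonneg w))
  linarith

lemma Vmn_quadratic (n m : ℤ) (lam : ℝ) (f a : ℝ → ℝ) (r : ℝ) (v : Fin 4 → ℝ) :
    ∑ k, v k * ∑ j, Vmn n m lam f a r k j * v j =
    (|(m:ℝ)|^2/r^2 + ((n:ℝ)*(1-a r)/r)^2) * (v 0^2+v 1^2)
      - 4*(|(m:ℝ)| * ((n:ℝ)*(1-a r)/r)/r)*v 0*v 1 + lam/2*(3*(f r)^2-1)*v 0^2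
      + (lam/2*((f r)^2-1)+(f r)^2)*v 1^2 - 4*((n:ℝ)*(1-a r)/r)*f r*v 0*v 2
      - 4*deriv f r*v 1*v 3 + ((|(m:ℝ)|^2+1)/r^2+(f r)^2)*(v 2^2+v 3^2)
      - 4*|(m:ℝ)|/r^2*v 2*v 3 := by
  simp [Fin.sum_univ_four, Vmn]
  ring

lemma Vmn_continuousOn (n m : ℤ) (lam : ℝ) {f a : ℝ → ℝ}
    (hf : ∀ r ∈ Ioi (0:ℝ), ContDiffAt ℝ (⊤ : ℕ∞) f r)
    (ha : ∀ r ∈ Ioi (0:ℝ), ContDiffAt ℝ (⊤ : ℕ∞) a r) (k j : Fin 4) :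
    ContinuousOn (fun r => Vmn n m lam f a r k j) (Ioi 0) := by
  have hf0 : ContinuousOn f (Ioi 0) := fun r hr => (hf r hr).continuousAt.continuousWithinAt
  have ha0 : ContinuousOn a (Ioi 0) := fun r hr => (ha r hr).continuousAt.continuousWithinAt
  have hf1 : ContinuousOn (deriv f) (Ioi 0) :=
    ContDiffOn.continuousOn_deriv_of_isOpen (fun r hr => (hf r hr).contDiffWithinAt)
      isOpen_Ioi (by simp)
  have h0 : ∀ r ∈ Ioi (0:ℝ), r ≠ 0 := fun r hr => ne_of_gt hr
  have h2 : ∀ r ∈ Ioi (0:ℝ), r^2 ≠ 0 := fun r hr => pow_ne_zero 2 (h0 r hr)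
  fin_cases k <;> fin_cases j <;> simp [Vmn] <;> fun_prop (disch := assumption)

lemma Vmn_tendsto (n m : ℤ) (lam : ℝ) {f a : ℝ → ℝ} (hflim : Tendsto f atTop (nhds 1))
    (hdecay : ∃ C c : ℝ, 0 < c ∧ ∀ r : ℝ, 1 ≤ r →
      |1 - a r| ≤ C * Real.exp (-c * r) ∧ |deriv f r| ≤ C * Real.exp (-c * r)) :
    Tendsto (fun r => Vmn n m lam f a r) atTop
      (nhds (Matrix.diagonal ![lam, 1, 1, 1])) := by
  obtain ⟨C, c, hc, hd⟩ := hdecay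
  have hexp : Tendsto (fun r : ℝ => C * Real.exp (-c * r)) atTop (nhds 0) := by
    have h : Tendsto (fun r : ℝ => Real.exp (-c * r)) atTop (nhds 0) :=
      Real.tendsto_exp_atBot.comp (tendsto_id.const_mul_atTop_of_neg (by linarith))
    simpa using h.const_mul C
  have ha : Tendsto (fun r => 1 - a r) atTop (nhds 0) :=
    squeeze_zero_norm' ((eventually_ge_atTop 1).mono fun r hr => (hd r hr).1) hexp
  have hf' : Tendsto (deriv f) atTop (nhds 0) :=
    squeeze_zero_norm' ((eventually_ge_atTop 1).mono fun r hr => (hd r hr).2) hexp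
  have hi : Tendsto (fun r : ℝ => r⁻¹) atTop (nhds 0) := tendsto_inv_atTop_zero
  let G : ℝ × ℝ × ℝ × ℝ → Matrix (Fin 4) (Fin 4) ℝ := fun p =>
    !![(m:ℝ)^2*p.2.2.2^2 + ((n:ℝ)*p.1*p.2.2.2)^2 + lam/2*(3*p.2.1^2 - 1),
       -2*|(m:ℝ)| * ((n:ℝ)*p.1*p.2.2.2)*p.2.2.2, -2*((n:ℝ)*p.1*p.2.2.2)*p.2.1, 0;
     -2*|(m:ℝ)| * ((n:ℝ)*p.1*p.2.2.2)*p.2.2.2,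
       (m:ℝ)^2*p.2.2.2^2 + ((n:ℝ)*p.1*p.2.2.2)^2 + lam/2*(p.2.1^2 - 1) + p.2.1^2, 0,
       -2*p.2.2.1;
     -2*((n:ℝ)*p.1*p.2.2.2)*p.2.1, 0, ((m:ℝ)^2+1)*p.2.2.2^2 + p.2.1^2,
       -2*|(m:ℝ)| * p.2.2.2^2;
     0, -2*p.2.2.1, -2*|(m:ℝ)| * p.2.2.2^2, ((m:ℝ)^2+1)*p.2.2.2^2 + p.2.1^2]
  have hG : Continuous G := by
    refine continuous_matrix fun k j => ?_
    fin_cases k <;> fin_cases j <;> simp [G] <;> fun_prop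
  have hlim := (hG.tendsto (0, 1, 0, 0)).comp
    (ha.prodMk_nhds (hflim.prodMk_nhds (hf'.prodMk_nhds hi)))
  have e0 : G (0, 1, 0, 0) = Matrix.diagonal ![lam, 1, 1, 1] := by
    ext k j
    fin_cases k <;> fin_cases j <;> simp [G, Matrix.diagonal]
    ring
  rw [e0] at hlim
  refine hlim.congr fun r => ?_
  simp [G, Vmn, div_eq_mul_inv]

lemma eventually_quadratic_ge {V : ℝ → Matrix (Fin 4) (Fin 4) ℝ} {lam : ℝ}
    (hV : Tendsto V atTop (nhds (Matrix.diagonal ![lam, 1, 1, 1]))) {ε : ℝ} (hε : 0 < ε) :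
    ∀ᶠ r in atTop, ∀ v : Fin 4 → ℝ,
      (min 1 lam - ε) * ∑ k, v k ^ 2 ≤ ∑ k, v k * ∑ j, V r k j * v j := by
  have h : ∀ k j, ∀ᶠ r in atTop,
      |V r k j - (Matrix.diagonal ![lam, 1, 1, 1] : Matrix (Fin 4) (Fin 4) ℝ) k j| < ε / 4 := by
    intro k j
    have := tendsto_pi_nhds.1 (tendsto_pi_nhds.1 hV k) j
    exact Metric.tendsto_nhds.1 this (ε / 4) (by positivity)
  filter_upwards [eventually_all.2 fun k => eventually_all.2 (h k)] with r hr v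
  set D : Matrix (Fin 4) (Fin 4) ℝ := Matrix.diagonal ![lam, 1, 1, 1] with hD
  have h1 : ∀ k j, v k * (V r k j * v j)
      ≥ v k * (D k j * v j) - ε / 8 * (v k ^ 2 + v j ^ 2) := by
    intro k j
    have e1 : |(V r k j - D k j) * (v k * v j)| ≤ ε / 4 * (|v k| * |v j|) := by
      rw [abs_mul, abs_mul]
      exact mul_le_mul_of_nonneg_right (hr k j).le (by positivity)
    have e2 := two_mul_le_add_sq |v k| |v j|
    rw [sq_abs, sq_abs] at e2
    have e3 := mul_le_mul_of_nonneg_left e2 (by positivity : 0 ≤ ε / 8)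
    have e4 := neg_abs_le ((V r k j - D k j) * (v k * v j))
    linarith
  have h2 : ∑ k, v k * ∑ j, V r k j * v j
      ≥ ∑ k, ∑ j, (v k * (D k j * v j) - ε / 8 * (v k ^ 2 + v j ^ 2)) := by
    simp only [Finset.mul_sum]
    exact Finset.sum_le_sum fun k _ => Finset.sum_le_sum fun j _ => h1 k j
  refine le_trans ?_ h2
  have m1 := mul_le_mul_of_nonneg_right (min_le_right 1 lam) (sq_nonneg (v 0))
  have m2 := mul_le_mul_of_nonneg_right (min_le_left 1 lam)
    (add_nonneg (add_nonneg (sq_nonneg (v 1)) (sq_nonneg (v 2))) (sq_nonneg (v 3)))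
  simp [Fin.sum_univ_four, hD, Matrix.diagonal]
  linarith

/-- The pointwise square of the Euclidean norm of `u`. -/
def normSqAt (u : ℝ → Fin 4 → ℝ) (r : ℝ) : ℝ := ∑ k, u r k ^ 2

/-- The pointwise square of the Euclidean norm of the derivative of `u`. -/
noncomputable def gradSqAt (u : ℝ → Fin 4 → ℝ) (r : ℝ) : ℝ :=
  ∑ k, deriv (fun s => u s k) r ^ 2

/-- The pointwise inner product of `u` with its derivative. -/
noncomputable def radialAt (u : ℝ → Fin 4 → ℝ) (r : ℝ) : ℝ :=
  ∑ k, u r k * deriv (fun s => u s k) r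

lemma normSqAt_nonneg (u : ℝ → Fin 4 → ℝ) (r : ℝ) : 0 ≤ normSqAt u r :=
  Finset.sum_nonneg fun _ _ => sq_nonneg _

lemma gradSqAt_nonneg (u : ℝ → Fin 4 → ℝ) (r : ℝ) : 0 ≤ gradSqAt u r :=
  Finset.sum_nonneg fun _ _ => sq_nonneg _

lemma abs_radialAt_le (u : ℝ → Fin 4 → ℝ) (r : ℝ) {η : ℝ} (hη : 0 < η) :
    2 * |radialAt u r| ≤ η * gradSqAt u r + η⁻¹ * normSqAt u r := by
  have h : ∀ x y : ℝ, 2 * |x * y| ≤ η * y ^ 2 + η⁻¹ * x ^ 2 := by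
    intro x y
    have e : η * y ^ 2 + η⁻¹ * x ^ 2 - 2 * (|x| * |y|) = η⁻¹ * (η * |y| - |x|) ^ 2 := by
      rw [← sq_abs x, ← sq_abs y]; field_simp; ring
    have : 0 ≤ η⁻¹ * (η * |y| - |x|) ^ 2 := by positivity
    rw [abs_mul]; linarith
  calc 2 * |radialAt u r| ≤ 2 * ∑ k, |u r k * deriv (fun s => u s k) r| := by
        gcongr; exact Finset.abs_sum_le_sum_abs _ _
    _ ≤ _ := by
        rw [gradSqAt, normSqAt, Finset.mul_sum, Finset.mul_sum, Finset.mul_sum,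
          ← Finset.sum_add_distrib]
        exact Finset.sum_le_sum fun k _ => h _ _

namespace IsTest

variable {u : ℝ → Fin 4 → ℝ}

lemma continuous_normSqAt (h : IsTest u) : Continuous (normSqAt u) := by
  unfold normSqAt
  have := h.continuous_comp
  fun_prop

lemma continuous_gradSqAt (h : IsTest u) : Continuous (gradSqAt u) := by
  unfold gradSqAt
  have := h.continuous_deriv
  fun_prop

lemma continuous_radialAt (h : IsTest u) : Continuous (radialAt u) := by
  unfold radialAt
  have := h.continuous_deriv
  have := h.continuous_comp
  fun_prop

lemma normSqAt_zero {r : ℝ} (hr : r ∉ tsupport u) : normSqAt u r = 0 := by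
  simp [normSqAt, zero hr]

lemma gradSqAt_zero {r : ℝ} (hr : r ∉ tsupport u) : gradSqAt u r = 0 := by
  simp [gradSqAt, deriv_zero hr]

lemma radialAt_zero {r : ℝ} (hr : r ∉ tsupport u) : radialAt u r = 0 := by
  simp [radialAt, deriv_zero hr]

lemma hasDerivAt_normSqAt (h : IsTest u) (r : ℝ) :
    HasDerivAt (normSqAt u) (2 * radialAt u r) r := by
  have := HasDerivAt.fun_sum (u := Finset.univ) fun k _ => (h.hasDerivAt k r).pow 2
  refine this.congr_deriv ?_
  simp [radialAt, Finset.mul_sum, mul_assoc]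

lemma integrableOn_normSqAt (h : IsTest u) :
    IntegrableOn (fun r => r * normSqAt u r) (Ioi 0) :=
  h.integrableOn (continuous_id.mul h.continuous_normSqAt).continuousOn
    fun r hr => by simp [normSqAt_zero hr]

lemma integrableOn_gradSqAt (h : IsTest u) :
    IntegrableOn (fun r => r * gradSqAt u r) (Ioi 0) :=
  h.integrableOn (continuous_id.mul h.continuous_gradSqAt).continuousOn
    fun r hr => by simp [gradSqAt_zero hr]

/-- A pointwise trace bound by the energy and the mass. -/
lemma trace_le (h : IsTest u) {R η : ℝ} (hR : 0 < R) (hη : 0 < η) :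
    R * normSqAt u R ≤ η * (∫ r in Ioi (0:ℝ), r * gradSqAt u r)
      + η⁻¹ * ∫ r in Ioi (0:ℝ), r * normSqAt u r := by
  have hN := h.continuous_normSqAt
  have hS := h.continuous_radialAt
  have h1 : ∫ r in Ioi R, (1 * normSqAt u r + r * (2 * radialAt u r))
      = -(R * normSqAt u R) :=
    h.integral_deriv (P := fun r => r * normSqAt u r)
      (fun r _ => (hasDerivAt_id r).mul (h.hasDerivAt_normSqAt r))
      (by fun_prop) (fun r hr => by simp [normSqAt_zero hr])
      (fun r hr => by simp [normSqAt_zero hr, radialAt_zero hr]) hR.le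
  have hi : IntegrableOn (fun r => η * (r * gradSqAt u r) + η⁻¹ * (r * normSqAt u r)) (Ioi 0) :=
    (h.integrableOn_gradSqAt.const_mul η).add (h.integrableOn_normSqAt.const_mul η⁻¹)
  have hi' : IntegrableOn (fun r => 1 * normSqAt u r + r * (2 * radialAt u r)) (Ioi 0) :=
    h.integrableOn (by fun_prop) fun r hr => by simp [normSqAt_zero hr, radialAt_zero hr]
  have h2 : ∫ r in Ioi R, -(1 * normSqAt u r + r * (2 * radialAt u r))
      ≤ ∫ r in Ioi R, (η * (r * gradSqAt u r) + η⁻¹ * (r * normSqAt u r)) := by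
    refine setIntegral_mono_on (hi'.mono_set (Ioi_subset_Ioi hR.le)).neg
      (hi.mono_set (Ioi_subset_Ioi hR.le)) measurableSet_Ioi fun r hr => ?_
    have hr0 : 0 < r := hR.trans hr
    have e1 := mul_le_mul_of_nonneg_left (abs_radialAt_le u r hη) hr0.le
    have e2 := mul_le_mul_of_nonneg_left (neg_abs_le (radialAt u r)) hr0.le
    have e3 := normSqAt_nonneg u r
    linarith
  have h3 : ∫ r in Ioi R, (η * (r * gradSqAt u r) + η⁻¹ * (r * normSqAt u r))
      ≤ ∫ r in Ioi (0:ℝ), (η * (r * gradSqAt u r) + η⁻¹ * (r * normSqAt u r)) := by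
    refine setIntegral_mono_set hi ?_ (Ioi_subset_Ioi hR.le).eventuallyLE
    filter_upwards [ae_restrict_mem measurableSet_Ioi] with r hr
    have hr0 : (0:ℝ) < r := hr
    have e3 := normSqAt_nonneg u r
    have e4 := gradSqAt_nonneg u r
    simp only [Pi.zero_apply]
    positivity
  rw [integral_neg, h1, neg_neg] at h2
  rw [integral_add (h.integrableOn_gradSqAt.const_mul η) (h.integrableOn_normSqAt.const_mul η⁻¹),
    integral_const_mul, integral_const_mul] at h3
  exact h2.trans h3

end IsTest

section Energy

variable {n m : ℤ} {lam : ℝ} {f a : ℝ → ℝ}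

/-- The quadratic form of the potential applied to `u`. -/
noncomputable def potentialAt (n m : ℤ) (lam : ℝ) (f a : ℝ → ℝ) (u : ℝ → Fin 4 → ℝ) (r : ℝ) : ℝ :=
  ∑ k, u r k * ∑ j, Vmn n m lam f a r k j * u r j

lemma IsTest.continuousOn_potentialAt {u : ℝ → Fin 4 → ℝ} (h : IsTest u)
    (hf : ∀ r ∈ Ioi (0:ℝ), ContDiffAt ℝ (⊤ : ℕ∞) f r)
    (ha : ∀ r ∈ Ioi (0:ℝ), ContDiffAt ℝ (⊤ : ℕ∞) a r) :
    ContinuousOn (potentialAt n m lam f a u) (Ioi 0) := by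
  have h1 := fun k j => Vmn_continuousOn n m lam hf ha k j
  have h2 : ∀ k, ContinuousOn (fun s => u s k) (Ioi 0) := fun k => (h.continuous_comp k).continuousOn
  unfold potentialAt
  exact continuousOn_finsetSum _ fun k _ => (h2 k).mul
    (continuousOn_finsetSum _ fun j _ => (h1 k j).mul (h2 j))

lemma IsTest.potentialAt_zero {u : ℝ → Fin 4 → ℝ} {r : ℝ} (hr : r ∉ tsupport u) :
    potentialAt n m lam f a u r = 0 := by
  simp [potentialAt, IsTest.zero hr]

lemma IsTest.integrableOn_form {u : ℝ → Fin 4 → ℝ} (h : IsTest u)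
    (hf : ∀ r ∈ Ioi (0:ℝ), ContDiffAt ℝ (⊤ : ℕ∞) f r)
    (ha : ∀ r ∈ Ioi (0:ℝ), ContDiffAt ℝ (⊤ : ℕ∞) a r) :
    IntegrableOn (fun r => r * (gradSqAt u r + potentialAt n m lam f a u r)) (Ioi 0) :=
  h.integrableOn (continuousOn_id.mul
    (h.continuous_gradSqAt.continuousOn.add (h.continuousOn_potentialAt hf ha)))
    fun r hr => by simp [IsTest.gradSqAt_zero hr, IsTest.potentialAt_zero hr]

lemma integral_inner_Lmn {u : ℝ → Fin 4 → ℝ} (h : IsTest u)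
    (hf : ∀ r ∈ Ioi (0:ℝ), ContDiffAt ℝ (⊤ : ℕ∞) f r)
    (ha : ∀ r ∈ Ioi (0:ℝ), ContDiffAt ℝ (⊤ : ℕ∞) a r) :
    ∫ r in Ioi (0:ℝ), r * ∑ k, u r k * Lmn n m lam f a u r k
      = ∫ r in Ioi (0:ℝ), r * (gradSqAt u r + potentialAt n m lam f a u r) := by
  set S2 : ℝ → ℝ := fun r => ∑ k, (deriv (fun s => u s k) r * deriv (fun s => u s k) r
    + u r k * deriv (deriv fun s => u s k) r) with hS2
  have c0 := h.continuous_comp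
  have c1 := h.continuous_deriv
  have c2 := h.continuous_deriv2
  have cS := h.continuous_radialAt
  have hd : ∀ r, HasDerivAt (radialAt u) (S2 r) r := fun r =>
    HasDerivAt.fun_sum (u := Finset.univ) fun k _ => (h.hasDerivAt k r).mul (h.hasDerivAt2 k r)
  have cS2 : Continuous S2 := by rw [hS2]; fun_prop
  have hz : ∀ r, r ∉ tsupport u → 1 * radialAt u r + r * S2 r = 0 := fun r hr => by
    simp [hS2, IsTest.radialAt_zero hr, IsTest.deriv_zero hr, IsTest.zero hr]
  have hP := h.integral_deriv (P := fun r => r * radialAt u r)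
      (P' := fun r => 1 * radialAt u r + r * S2 r)
      (fun r _ => (hasDerivAt_id r).mul (hd r))
      (by fun_prop) (fun r hr => by simp [IsTest.radialAt_zero hr]) hz le_rfl
  have hi : IntegrableOn (fun r => 1 * radialAt u r + r * S2 r) (Ioi 0) :=
    h.integrableOn (by fun_prop) hz
  rw [zero_mul, neg_zero] at hP
  have e : ∫ r in Ioi (0:ℝ), r * ∑ k, u r k * Lmn n m lam f a u r k
      = ∫ r in Ioi (0:ℝ), (r * (gradSqAt u r + potentialAt n m lam f a u r)
        - (1 * radialAt u r + r * S2 r)) := by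
    refine setIntegral_congr_fun measurableSet_Ioi fun r hr => ?_
    have hr0 : r ≠ 0 := ne_of_gt hr
    obtain ⟨W, hW⟩ : ∃ W : Fin 4 → ℝ, W = fun k => ∑ j, Vmn n m lam f a r k j * u r j := ⟨_, rfl⟩
    have eL : ∀ k, Lmn n m lam f a u r k = -(deriv (deriv fun s => u s k) r)
        - deriv (fun s => u s k) r / r + W k := fun k => by rw [hW]; rfl
    have eP : potentialAt n m lam f a u r = ∑ k, u r k * W k := by rw [hW]; rfl
    simp only [eL, eP, gradSqAt, radialAt, hS2, Fin.sum_univ_four]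
    field_simp
    ring
  rw [e, integral_sub (h.integrableOn_form hf ha) hi, hP, sub_zero]

/-- Garding-type inequality: the form is bounded below by the energy and the limiting potential,
up to terms localized in a bounded interval. -/
lemma energy_lower_bound (hlam : 0 < lam)
    (hf : ∀ r ∈ Ioi (0:ℝ), ContDiffAt ℝ (⊤ : ℕ∞) f r)
    (ha : ∀ r ∈ Ioi (0:ℝ), ContDiffAt ℝ (⊤ : ℕ∞) a r)
    {C : ℝ} (hfbdd : ∀ r ∈ Ioi (0:ℝ), |f r| ≤ C) {R l : ℝ} (hR : 0 < R)
    (hfar : ∀ r, R ≤ r → ∀ v : Fin 4 → ℝ,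
      l * ∑ k, v k ^ 2 ≤ ∑ k, v k * ∑ j, Vmn n m lam f a r k j * v j) :
    ∃ K : ℝ, 0 < K ∧ ∀ u, IsTest u →
      1 / 2 * (∫ r in Ioi (0:ℝ), r * gradSqAt u r) + l * (∫ r in Ioi (0:ℝ), r * normSqAt u r)
        - K * ((∫ r in Ioc 0 R, r * normSqAt u r) + R * normSqAt u R)
      ≤ ∫ r in Ioi (0:ℝ), r * ∑ k, u r k * Lmn n m lam f a u r k := by
  have hC : 0 ≤ C := (abs_nonneg _).trans (hfbdd 1 (by simp))
  set M : ℝ := |(m:ℝ)| with hM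
  have hM0 : 0 ≤ M := abs_nonneg _
  set K3 : ℝ := 2 * C * M + 2 * C with hK3
  have hK30 : 0 ≤ K3 := by positivity
  set K4 : ℝ := lam / 2 + 4 * C ^ 2 + 16 * C ^ 2 + 4 * K3 ^ 2 with hK4
  have hK40 : 0 < K4 := by positivity
  refine ⟨K4 + |l| + 2 * C + K3, by positivity, fun u h => ?_⟩
  rw [integral_inner_Lmn h hf ha]
  have c0 := h.continuous_comp
  have c1 := h.continuous_deriv
  have cN := h.continuous_normSqAt
  have cS := h.continuous_radialAt
  have cf : ContinuousOn f (Ioi 0) := fun r hr => (hf r hr).continuousAt.continuousWithinAt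
  have cf' : ContinuousOn (deriv f) (Ioi 0) :=
    ContDiffOn.continuousOn_deriv_of_isOpen (fun r hr => (hf r hr).contDiffWithinAt)
      isOpen_Ioi (by simp)
  set H : ℝ → ℝ := fun r => r * (4 * (f r * (u r 1 * u r 3)) + K3 * normSqAt u r) with hH
  set H' : ℝ → ℝ := fun r => 1 * (4 * (f r * (u r 1 * u r 3)) + K3 * normSqAt u r)
    + r * (4 * (deriv f r * (u r 1 * u r 3) + f r * (deriv (fun s => u s 1) r * u r 3
      + u r 1 * deriv (fun s => u s 3) r)) + K3 * (2 * radialAt u r)) with hH'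
  have hd : ∀ r ∈ Ioi (0:ℝ), HasDerivAt H (H' r) r := fun r hr =>
    (hasDerivAt_id r).mul (((((hf r hr).differentiableAt (by simp)).hasDerivAt.mul
      ((h.hasDerivAt 1 r).mul (h.hasDerivAt 3 r))).const_mul 4).add
      ((h.hasDerivAt_normSqAt r).const_mul K3))
  have cH' : ContinuousOn H' (Ioi 0) := by
    have d1 := (c1 1).continuousOn (s := Ioi 0)
    have d3 := (c1 3).continuousOn (s := Ioi 0)
    rw [hH']; fun_prop
  have z0 : ∀ r, r ∉ tsupport u → H r = 0 := fun r hr => by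
    simp [hH, IsTest.zero hr, IsTest.normSqAt_zero hr]
  have z1 : ∀ r, r ∉ tsupport u → H' r = 0 := fun r hr => by
    simp [hH', IsTest.zero hr, IsTest.normSqAt_zero hr, IsTest.radialAt_zero hr]
  have iH' := h.integrableOn cH' z1
  have iN := h.integrableOn_normSqAt
  have iG := h.integrableOn_gradSqAt
  have iF := h.integrableOn_form (n := n) (m := m) (lam := lam) hf ha
  have iD : IntegrableOn (fun r => 1 / 2 * (r * gradSqAt u r) - K4 * (r * normSqAt u r)) (Ioi 0) :=
    (iG.const_mul _).sub (iN.const_mul _)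
  have iA : IntegrableOn (fun r => 1 / 2 * (r * gradSqAt u r) - K4 * (r * normSqAt u r) - H' r)
      (Ioi 0) := iD.sub iH'
  have iB : IntegrableOn (fun r => 1 / 2 * (r * gradSqAt u r) + l * (r * normSqAt u r)) (Ioi 0) :=
    (iG.const_mul _).add (iN.const_mul _)
  have split : ∀ {F : ℝ → ℝ}, IntegrableOn F (Ioi 0) →
      ∫ r in Ioi (0:ℝ), F r = (∫ r in Ioc 0 R, F r) + ∫ r in Ioi R, F r := by
    intro F hF
    rw [← Ioc_union_Ioi_eq_Ioi hR.le]
    exact setIntegral_union (Ioc_disjoint_Ioi le_rfl) measurableSet_Ioi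
      (hF.mono_set Ioc_subset_Ioi_self) (hF.mono_set (Ioi_subset_Ioi hR.le))
  have hI0 := h.integral_deriv hd cH' z0 z1 le_rfl
  have hIR := h.integral_deriv hd cH' z0 z1 hR.le
  have hHI : ∫ r in Ioc 0 R, H' r = H R := by
    have := split iH'
    have e : H 0 = 0 := by simp [hH]
    rw [hI0, hIR, e] at this
    linarith
  have hprod : ∀ r ∈ Ioi (0:ℝ), |f r * (u r 1 * u r 3)| ≤ C / 2 * normSqAt u r := by
    intro r hr
    rw [abs_mul, abs_mul]
    have e1 := two_mul_le_add_sq |u r 1| |u r 3|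
    rw [sq_abs, sq_abs] at e1
    have e2 : u r 1 ^ 2 + u r 3 ^ 2 ≤ normSqAt u r := by
      simp only [normSqAt, Fin.sum_univ_four]
      linarith [sq_nonneg (u r 0), sq_nonneg (u r 2)]
    calc |f r| * (|u r 1| * |u r 3|) ≤ C * (normSqAt u r / 2) :=
          mul_le_mul (hfbdd r hr) (by linarith) (by positivity) hC
      _ = _ := by ring
  have hHR : H R ≤ (2 * C + K3) * (R * normSqAt u R) := by
    have e := mul_le_mul_of_nonneg_left ((le_abs_self _).trans (hprod R hR)) hR.le
    simp only [hH]
    linarith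
  have near : ∫ r in Ioc 0 R, (1 / 2 * (r * gradSqAt u r) - K4 * (r * normSqAt u r) - H' r)
      ≤ ∫ r in Ioc 0 R, r * (gradSqAt u r + potentialAt n m lam f a u r) := by
    refine setIntegral_mono_on (iA.mono_set Ioc_subset_Ioi_self) (iF.mono_set Ioc_subset_Ioi_self) measurableSet_Ioc fun r hr => ?_
    have hr0 : 0 < r := hr.1
    have hq := quadratic_lower_bound (b := (n:ℝ)*(1-a r)/r) (F' := deriv f r) (x := u r 0)
      (y := u r 1) (z := u r 2) (w := u r 3) hM0 hlam hr0 (hfbdd r hr0)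
    have hV : potentialAt n m lam f a u r ≥ -(lam/2+4*C^2) * normSqAt u r
        - 2*C*M * normSqAt u r / r - 4 * deriv f r * u r 1 * u r 3 := by
      rw [potentialAt, Vmn_quadratic]
      simp only [normSqAt, Fin.sum_univ_four]
      linarith
    have hV' := mul_le_mul_of_nonneg_left hV hr0.le
    have eV : r * (-(lam/2+4*C^2) * normSqAt u r
        - 2*C*M * normSqAt u r / r - 4 * deriv f r * u r 1 * u r 3)
        = -(lam/2+4*C^2) * (r * normSqAt u r) - 2*C*M * normSqAt u r
          - 4 * r * (deriv f r * (u r 1 * u r 3)) := by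
      field_simp
    rw [eV] at hV'
    have p1 := (abs_le.1 (hprod r hr0)).1
    have cross : ∀ x y : ℝ, |f r * (x * y)| * 4 ≤ 1 / 4 * x ^ 2 + 16 * C ^ 2 * y ^ 2 := by
      intro x y
      rw [abs_mul, abs_mul]
      have e1 : |f r| * (|x| * |y|) ≤ C * (|x| * |y|) :=
        mul_le_mul_of_nonneg_right (hfbdd r hr0) (by positivity)
      have e2 := two_mul_le_add_sq (1 / 2 * |x|) (4 * C * |y|)
      rw [mul_pow, mul_pow, sq_abs, sq_abs] at e2
      linarith
    have q1 := cross (deriv (fun s => u s 1) r) (u r 3)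
    have q2 := cross (deriv (fun s => u s 3) r) (u r 1)
    have q3 := neg_abs_le (f r * (deriv (fun s => u s 1) r * u r 3))
    have q4 := neg_abs_le (f r * (deriv (fun s => u s 3) r * u r 1))
    have q5 := neg_abs_le (radialAt u r)
    have g1 : deriv (fun s => u s 1) r ^ 2 + deriv (fun s => u s 3) r ^ 2 ≤ gradSqAt u r := by
      simp only [gradSqAt, Fin.sum_univ_four]
      linarith [sq_nonneg (deriv (fun s => u s 0) r), sq_nonneg (deriv (fun s => u s 2) r)]
    have g2 : C ^ 2 * (u r 1 ^ 2 + u r 3 ^ 2) ≤ C ^ 2 * normSqAt u r := by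
      refine mul_le_mul_of_nonneg_left ?_ (sq_nonneg C)
      simp only [normSqAt, Fin.sum_univ_four]
      linarith [sq_nonneg (u r 0), sq_nonneg (u r 2)]
    have q6 : 2 * K3 * |radialAt u r| ≤ 1 / 4 * gradSqAt u r + 4 * K3 ^ 2 * normSqAt u r := by
      rcases hK30.eq_or_lt with h0 | hpos
      · rw [← h0]; simp [gradSqAt_nonneg]
      · have e := mul_le_mul_of_nonneg_left (abs_radialAt_le u r
          (by positivity : 0 < 1 / (4 * K3))) hK30
        have e1 : K3 * (1 / (4 * K3) * gradSqAt u r + (1 / (4 * K3))⁻¹ * normSqAt u r)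
          = 1 / 4 * gradSqAt u r + 4 * K3 ^ 2 * normSqAt u r := by
          field_simp
        linarith
    have q7 : 4 * (f r * (deriv (fun s => u s 1) r * u r 3 + u r 1 * deriv (fun s => u s 3) r))
        + K3 * (2 * radialAt u r) ≥ -(1 / 2 * gradSqAt u r)
          - (16 * C ^ 2 + 4 * K3 ^ 2) * normSqAt u r := by
      have := mul_le_mul_of_nonneg_left q5 hK30
      linarith
    have q8 := mul_le_mul_of_nonneg_left q7 hr0.le
    simp only [hH', hK4]
    have p2 : K3 * normSqAt u r = 2 * C * M * normSqAt u r + 2 * C * normSqAt u r := by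
      rw [hK3]; ring
    linarith
  have far : ∫ r in Ioi R, (1 / 2 * (r * gradSqAt u r) + l * (r * normSqAt u r))
      ≤ ∫ r in Ioi R, r * (gradSqAt u r + potentialAt n m lam f a u r) := by
    refine setIntegral_mono_on (iB.mono_set (Ioi_subset_Ioi hR.le)) (iF.mono_set (Ioi_subset_Ioi hR.le)) measurableSet_Ioi fun r hr => ?_
    have hr0 : 0 < r := hR.trans hr
    have e1 := mul_le_mul_of_nonneg_left (hfar r (le_of_lt hr) (u r)) hr0.le
    have e2 := mul_nonneg hr0.le (gradSqAt_nonneg u r)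
    simp only [potentialAt, normSqAt]
    linarith
  have s1 : Ioc 0 R ⊆ Ioi 0 := Ioc_subset_Ioi_self
  have s2 : Ioi R ⊆ Ioi 0 := Ioi_subset_Ioi hR.le
  rw [integral_sub (iD.mono_set s1) (iH'.mono_set s1),
    integral_sub ((iG.mono_set s1).const_mul _) ((iN.mono_set s1).const_mul _),
    integral_const_mul, integral_const_mul, hHI] at near
  rw [integral_add ((iG.mono_set s2).const_mul _) ((iN.mono_set s2).const_mul _),
    integral_const_mul, integral_const_mul] at far
  have T0 : 0 ≤ ∫ r in Ioc 0 R, r * normSqAt u r :=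
    setIntegral_nonneg measurableSet_Ioc fun r hr => mul_nonneg hr.1.le (normSqAt_nonneg u r)
  have P0 : 0 ≤ R * normSqAt u R := mul_nonneg hR.le (normSqAt_nonneg u R)
  rw [split iF, split iG, split iN]
  have l1 := mul_le_mul_of_nonneg_right (le_abs_self l) T0
  have l2 := mul_nonneg (by positivity : 0 ≤ 2 * C + K3) T0
  have l3 := mul_nonneg (by positivity : 0 ≤ K4 + |l|) P0
  linarith

end Energy

section LowerBound

variable {n m : ℤ} {lam : ℝ} {f a : ℝ → ℝ}

instance : IsLocallyFiniteMeasure rmeasure :=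
  IsLocallyFiniteMeasure.withDensity_ofReal continuous_id

lemma setIntegral_rmeasure {S : Set ℝ} (hS : MeasurableSet S) (hS0 : S ⊆ Ioi 0) (g : ℝ → ℝ) :
    ∫ r in S, g r ∂rmeasure = ∫ r in S, r * g r := by
  rw [← integral_indicator hS, integral_rmeasure]
  have : (fun r => r * S.indicator g r) = S.indicator fun r => r * g r := by
    ext r; by_cases h : r ∈ S <;> simp [h]
  rw [this, setIntegral_indicator hS, inter_eq_right.2 hS0]

/-- An orthonormal sequence of test functions converges to zero in mean on intervals. -/
lemma tendsto_integral_of_orthonormal {u : ℕ → ℝ → Fin 4 → ℝ} (hu : ∀ j, IsTest (u j))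
    (horth : ∀ i j, (∫ r, (∑ k, u i r k * u j r k) ∂rmeasure) = if i = j then (1:ℝ) else 0)
    {r : ℝ} (hr : 0 < r) (d : ℝ) (k : Fin 4) :
    Tendsto (fun j => ∫ s in Ioc r (r + d), s * u j s k) atTop (nhds 0) := by
  let g : ℕ → ℝ → EuclideanSpace ℝ (Fin 4) := fun j s => WithLp.toLp 2 (u j s)
  have hg : ∀ j, MemLp (g j) 2 rmeasure := fun j =>
    Continuous.memLp_of_hasCompactSupport
      ((PiLp.continuous_toLp 2 _).comp (hu j).smooth.continuous)
      ((hu j).compact.comp_left (g := fun v => WithLp.toLp 2 v) (by simp))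
  let w : ℕ → Lp (EuclideanSpace ℝ (Fin 4)) 2 rmeasure := fun j => (hg j).toLp
  have how : Orthonormal ℝ w := by
    rw [orthonormal_iff_ite]
    intro i j
    rw [L2.inner_def, ← horth i j]
    refine integral_congr_ae ?_
    filter_upwards [(hg i).coeFn_toLp, (hg j).coeFn_toLp] with s hi hj
    simp only [w, hi, hj, g, PiLp.inner_apply]
    refine Finset.sum_congr rfl fun k _ => ?_
    simp [mul_comm]
  have hfin : rmeasure (Ioc r (r + d)) ≠ ⊤ :=
    (measure_mono Ioc_subset_Icc_self |>.trans_lt isCompact_Icc.measure_lt_top).ne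
  have hsum := how.inner_products_summable
    (indicatorConstLp 2 measurableSet_Ioc hfin (EuclideanSpace.single k (1:ℝ)))
  have h0 := hsum.tendsto_atTop_zero
  have e : ∀ j, inner ℝ (w j)
      (indicatorConstLp 2 measurableSet_Ioc hfin (EuclideanSpace.single k (1:ℝ)))
      = ∫ s in Ioc r (r + d), s * u j s k := by
    intro j
    rw [real_inner_comm, L2.inner_indicatorConstLp_eq_setIntegral_inner,
      ← setIntegral_rmeasure measurableSet_Ioc
        (Ioc_subset_Ioi_self.trans (Ioi_subset_Ioi hr.le))]
    refine integral_congr_ae (ae_restrict_of_ae ?_)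
    filter_upwards [(hg j).coeFn_toLp] with s hs
    simp [w, hs, g, EuclideanSpace.inner_single_left]
  simp only [e, Real.norm_eq_abs, sq_abs] at h0
  have h1 := h0.sqrt
  simp only [Real.sqrt_sq_eq_abs, Real.sqrt_zero] at h1
  exact tendsto_zero_iff_abs_tendsto_zero _ |>.2 h1

/-- A pointwise bound by a local average and the energy. -/
lemma IsTest.abs_le_average {u : ℝ → Fin 4 → ℝ} (h : IsTest u) {r d η : ℝ} (hr : 0 < r)
    (hd : 0 < d) (hη : 0 < η) (k : Fin 4) :
    |u r k| ≤ (r * d + d ^ 2 / 2)⁻¹ * |∫ s in Ioc r (r + d), s * u s k|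
      + (η / 2 * (∫ s in Ioi (0:ℝ), s * gradSqAt u s) + d / (2 * η * r)) := by
  have c0 := h.continuous_comp k
  have c1 := h.continuous_deriv k
  set Ψ : ℝ := r * d + d ^ 2 / 2 with hΨ
  have hΨ0 : 0 < Ψ := by positivity
  set ψ : ℝ → ℝ := fun s => ((r + d) ^ 2 - s ^ 2) / 2 with hψ
  have cψ : Continuous ψ := by fun_prop
  have hψd : ∀ s, HasDerivAt ψ (-s) s := fun s =>
    (((hasDerivAt_id s).pow 2).const_sub ((r + d) ^ 2)).div_const 2 |>.congr_deriv (by simp; ring)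
  have hle : r ≤ r + d := by linarith
  have hF := intervalIntegral.integral_eq_sub_of_hasDerivAt (a := r) (b := r + d)
    (fun s _ => (hψd s).mul (h.hasDerivAt k s))
    (Continuous.intervalIntegrable (by fun_prop) _ _)
  have e1 : ψ (r + d) = 0 := by simp [hψ]
  have e2 : ψ r = Ψ := by simp only [hψ, hΨ]; ring
  simp only [Pi.mul_apply] at hF
  rw [intervalIntegral.integral_add (Continuous.intervalIntegrable (by fun_prop) _ _)
    (Continuous.intervalIntegrable (by fun_prop) _ _), e1, e2,
    intervalIntegral.integral_of_le hle, intervalIntegral.integral_of_le hle] at hF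
  simp only [neg_mul, integral_neg] at hF
  have hsub : Ioc r (r + d) ⊆ Ioi 0 := Ioc_subset_Ioi_self.trans (Ioi_subset_Ioi hr.le)
  have iG := h.integrableOn_gradSqAt
  have ic : IntegrableOn (fun _ : ℝ => Ψ * (1 / (2 * η * r))) (Ioc r (r + d)) :=
    continuous_const.integrableOn_Ioc
  have ig : IntegrableOn (fun s => Ψ * (η / 2) * (s * gradSqAt u s)) (Ioc r (r + d)) :=
    (iG.mono_set hsub).const_mul _
  have iadd : IntegrableOn (fun s => Ψ * (η / 2) * (s * gradSqAt u s)
      + Ψ * (1 / (2 * η * r))) (Ioc r (r + d)) := ig.add ic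
  have hb : |∫ s in Ioc r (r + d), ψ s * deriv (fun s => u s k) s|
      ≤ ∫ s in Ioc r (r + d), (Ψ * (η / 2) * (s * gradSqAt u s) + Ψ * (1 / (2 * η * r))) := by
    rw [← Real.norm_eq_abs]
    refine norm_integral_le_of_norm_le iadd ?_
    filter_upwards [ae_restrict_mem measurableSet_Ioc] with s hs
    have hs0 : 0 < s := hr.trans hs.1
    have p1 : 0 ≤ ψ s := by
      simp only [hψ]
      nlinarith [hs.1, hs.2]
    have p2 : ψ s ≤ Ψ := by
      rw [← e2]; simp only [hψ]
      nlinarith [hs.1, hs.2]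
    have p3 : |deriv (fun s => u s k) s| ≤ η / 2 * (s * gradSqAt u s) + 1 / (2 * η * r) := by
      have q1 : deriv (fun s => u s k) s ^ 2 ≤ gradSqAt u s :=
        Finset.single_le_sum (f := fun k => deriv (fun s => u s k) s ^ 2)
          (fun _ _ => sq_nonneg _) (Finset.mem_univ k)
      have q2 : 1 / (2 * η * s) ≤ 1 / (2 * η * r) :=
        one_div_le_one_div_of_le (by positivity) (by have := hs.1; gcongr)
      have q3 : η / 2 * (s * deriv (fun s => u s k) s ^ 2) + 1 / (2 * η * s)
          - |deriv (fun s => u s k) s|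
          = (η * s * |deriv (fun s => u s k) s| - 1) ^ 2 / (2 * η * s) := by
        rw [← sq_abs (deriv (fun s => u s k) s)]
        field_simp
        ring
      have q4 : 0 ≤ (η * s * |deriv (fun s => u s k) s| - 1) ^ 2 / (2 * η * s) := by positivity
      have q5 : η / 2 * (s * deriv (fun s => u s k) s ^ 2) ≤ η / 2 * (s * gradSqAt u s) := by
        gcongr
      linarith
    rw [norm_mul, Real.norm_eq_abs, Real.norm_eq_abs, abs_of_nonneg p1]
    calc ψ s * |deriv (fun s => u s k) s|
        ≤ Ψ * (η / 2 * (s * gradSqAt u s) + 1 / (2 * η * r)) :=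
          mul_le_mul p2 p3 (abs_nonneg _) hΨ0.le
      _ = _ := by ring
  have hG : ∫ s in Ioc r (r + d), s * gradSqAt u s ≤ ∫ s in Ioi (0:ℝ), s * gradSqAt u s := by
    refine setIntegral_mono_set iG ?_ hsub.eventuallyLE
    filter_upwards [ae_restrict_mem measurableSet_Ioi] with s hs
    exact mul_nonneg (le_of_lt hs) (gradSqAt_nonneg u s)
  rw [integral_add ig ic, integral_const_mul] at hb
  have hvol : ∫ _ in Ioc r (r + d), Ψ * (1 / (2 * η * r)) = Ψ * (d / (2 * η * r)) := by
    simp [hd.le]; ring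
  rw [hvol] at hb
  have hfin : Ψ * |u r k| ≤ |∫ s in Ioc r (r + d), s * u s k|
      + Ψ * (η / 2 * (∫ s in Ioi (0:ℝ), s * gradSqAt u s) + d / (2 * η * r)) := by
    have t1 : Ψ * u r k = (∫ s in Ioc r (r + d), s * u s k)
        - ∫ s in Ioc r (r + d), ψ s * deriv (fun s => u s k) s := by linarith
    have t2 : Ψ * |u r k| = |Ψ * u r k| := by rw [abs_mul, abs_of_pos hΨ0]
    have t3 := abs_sub (∫ s in Ioc r (r + d), s * u s k)
      (∫ s in Ioc r (r + d), ψ s * deriv (fun s => u s k) s)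
    have t4 := mul_le_mul_of_nonneg_left hG (by positivity : 0 ≤ Ψ * (η / 2))
    rw [t2, t1]
    linarith
  have := mul_le_mul_of_nonneg_left hfin (inv_nonneg.2 hΨ0.le)
  rw [mul_add, inv_mul_cancel_left₀ hΨ0.ne', inv_mul_cancel_left₀ hΨ0.ne'] at this
  exact this

lemma tendsto_zero_of_orthonormal {u : ℕ → ℝ → Fin 4 → ℝ} (hu : ∀ j, IsTest (u j))
    (horth : ∀ i j, (∫ r, (∑ k, u i r k * u j r k) ∂rmeasure) = if i = j then (1:ℝ) else 0)
    {B : ℝ} (hB : ∀ j, ∫ s in Ioi (0:ℝ), s * gradSqAt (u j) s ≤ B)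
    {r : ℝ} (hr : 0 < r) (k : Fin 4) :
    Tendsto (fun j => u j r k) atTop (nhds 0) := by
  rw [Metric.tendsto_atTop']
  intro ε hε
  set A : ℝ := |B| + 1 / r + 1 with hA
  have hA0 : 0 < A := by positivity
  set η : ℝ := ε / (2 * A) with hη
  have hη0 : 0 < η := by positivity
  have ht := tendsto_integral_of_orthonormal hu horth hr (η ^ 2) k
  have ht' := (ht.abs.const_mul (r * η ^ 2 + (η ^ 2) ^ 2 / 2)⁻¹)
  rw [abs_zero, mul_zero] at ht'
  obtain ⟨N, hN⟩ := eventually_atTop.1 (ht'.eventually_lt_const (half_pos hε))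
  refine ⟨N, fun j hj => ?_⟩
  have h1 := (hu j).abs_le_average hr (by positivity : 0 < η ^ 2) hη0 k
  have h2 := hN j hj.le
  have h3 : η / 2 * (∫ s in Ioi (0:ℝ), s * gradSqAt (u j) s) ≤ η / 2 * |B| := by
    have := (hB j).trans (le_abs_self B)
    gcongr
  have h4 : η ^ 2 / (2 * η * r) = η / 2 * (1 / r) := by field_simp
  have h5 : η * A = ε / 2 := by rw [hη]; field_simp
  have h6 : 0 < η * (|B| + 1 / r) := by positivity
  rw [Real.dist_eq, sub_zero]
  rw [h4] at h1
  have h7 : η * A = η * (|B| + 1 / r) + η := by rw [hA]; ring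
  linarith

lemma IsTest.continuousOn_Lmn {u : ℝ → Fin 4 → ℝ} (h : IsTest u)
    (hf : ∀ r ∈ Ioi (0:ℝ), ContDiffAt ℝ (⊤ : ℕ∞) f r)
    (ha : ∀ r ∈ Ioi (0:ℝ), ContDiffAt ℝ (⊤ : ℕ∞) a r) (k : Fin 4) :
    ContinuousOn (fun r => Lmn n m lam f a u r k) (Ioi 0) := by
  have h1 := fun j => Vmn_continuousOn n m lam hf ha k j
  unfold Lmn
  exact ((h.continuous_deriv2 k).continuousOn.neg.sub
    ((h.continuous_deriv k).continuousOn.div continuousOn_id fun r hr => ne_of_gt hr)).add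
    (continuousOn_finsetSum _ fun j _ => (h1 j).mul (h.continuous_comp j).continuousOn)

lemma IsTest.Lmn_zero {u : ℝ → Fin 4 → ℝ} {r : ℝ} (hr : r ∉ tsupport u) (k : Fin 4) :
    Lmn n m lam f a u r k = 0 := by
  simp [Lmn, IsTest.zero hr, IsTest.deriv_zero hr, IsTest.deriv2_zero hr]

lemma integral_inner_Lmn_le {u : ℝ → Fin 4 → ℝ} (h : IsTest u)
    (hf : ∀ r ∈ Ioi (0:ℝ), ContDiffAt ℝ (⊤ : ℕ∞) f r)
    (ha : ∀ r ∈ Ioi (0:ℝ), ContDiffAt ℝ (⊤ : ℕ∞) a r) (μ : ℝ) {δ : ℝ} (hδ : 0 < δ) :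
    ∫ r in Ioi (0:ℝ), r * ∑ k, u r k * Lmn n m lam f a u r k
      ≤ (μ + δ) * (∫ r in Ioi (0:ℝ), r * normSqAt u r)
        + δ⁻¹ * ∫ r, (∑ k, (Lmn n m lam f a u r k - μ * u r k) ^ 2) ∂rmeasure := by
  have c0 : ∀ k, ContinuousOn (fun s => u s k) (Ioi 0) := fun k => (h.continuous_comp k).continuousOn
  have c1 := fun k => h.continuousOn_Lmn (n := n) (m := m) (lam := lam) hf ha k
  have i1 : IntegrableOn (fun r => r * ∑ k, u r k * Lmn n m lam f a u r k) (Ioi 0) :=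
    h.integrableOn (continuousOn_id.mul (continuousOn_finsetSum _ fun k _ => (c0 k).mul (c1 k)))
      fun r hr => by simp [IsTest.zero hr]
  have i2 : IntegrableOn (fun r => r * ∑ k, (Lmn n m lam f a u r k - μ * u r k) ^ 2) (Ioi 0) :=
    h.integrableOn (continuousOn_id.mul (continuousOn_finsetSum _ fun k _ =>
      ((c1 k).sub ((c0 k).const_mul μ)).pow 2))
      fun r hr => by simp [IsTest.zero hr, IsTest.Lmn_zero hr]
  rw [integral_rmeasure, ← integral_const_mul, ← integral_const_mul,
    ← integral_add (h.integrableOn_normSqAt.const_mul _) (i2.const_mul _)]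
  refine setIntegral_mono_on i1 ((h.integrableOn_normSqAt.const_mul _).add (i2.const_mul _))
    measurableSet_Ioi fun r hr => ?_
  have hr0 : (0:ℝ) < r := hr
  have e : ∑ k, u r k * Lmn n m lam f a u r k ≤ (μ + δ) * normSqAt u r
      + δ⁻¹ * ∑ k, (Lmn n m lam f a u r k - μ * u r k) ^ 2 := by
    rw [normSqAt, Finset.mul_sum, Finset.mul_sum, ← Finset.sum_add_distrib]
    refine Finset.sum_le_sum fun k _ => ?_
    have key : ∀ x y : ℝ, x * y ≤ δ * x ^ 2 + δ⁻¹ * y ^ 2 := by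
      intro x y
      have e : δ * x ^ 2 + δ⁻¹ * y ^ 2 - x * y
          = δ⁻¹ * ((δ * x - y / 2) ^ 2 + 3 / 4 * y ^ 2) := by field_simp; ring
      have : 0 ≤ δ⁻¹ * ((δ * x - y / 2) ^ 2 + 3 / 4 * y ^ 2) := by positivity
      linarith
    have := key (u r k) (Lmn n m lam f a u r k - μ * u r k)
    linarith
  have := mul_le_mul_of_nonneg_left e hr0.le
  linarith

lemma min_le_of_mem_essSpecRad (hlam : 0 < lam)
    (hf : ∀ r ∈ Ioi (0:ℝ), ContDiffAt ℝ (⊤ : ℕ∞) f r)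
    (ha : ∀ r ∈ Ioi (0:ℝ), ContDiffAt ℝ (⊤ : ℕ∞) a r)
    {C : ℝ} (hfbdd : ∀ r ∈ Ioi (0:ℝ), |f r| ≤ C)
    (hV : Tendsto (fun r => Vmn n m lam f a r) atTop
      (nhds (Matrix.diagonal ![lam, 1, 1, 1]))) {μ : ℝ}
    (hμ : μ ∈ essSpecRad (Lmn n m lam f a)) : min 1 lam ≤ μ := by
  obtain ⟨u, h1, h2, h3, horth, hE⟩ := hμ
  have hu : ∀ j, IsTest (u j) := fun j => ⟨h1 j, h2 j, h3 j⟩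
  refine le_of_forall_pos_le_add fun ε' hε' => ?_
  obtain ⟨ε, hε, rfl⟩ : ∃ ε, 0 < ε ∧ ε' = 2 * ε := ⟨ε' / 2, by positivity, by ring⟩
  obtain ⟨R₀, hR₀⟩ := eventually_atTop.1 (eventually_quadratic_ge hV hε)
  set R : ℝ := max R₀ 1 with hRdef
  have hR : 0 < R := lt_of_lt_of_le one_pos (le_max_right _ _)
  set l : ℝ := min 1 lam - ε with hl
  obtain ⟨K, hK, hbound⟩ := energy_lower_bound (n := n) (m := m) hlam hf ha hfbdd hR (l := l)
    fun r hr v => hR₀ r ((le_max_left _ _).trans hr) v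
  set E : ℕ → ℝ := fun j => ∫ r, (∑ k, (Lmn n m lam f a (u j) r k - μ * u j r k)^2) ∂rmeasure
    with hEdef
  have hN : ∀ j, ∫ r in Ioi (0:ℝ), r * normSqAt (u j) r = 1 := by
    intro j
    rw [← integral_rmeasure]
    have := horth j j
    rw [if_pos rfl] at this
    rw [← this]
    simp only [normSqAt, sq]
  have hT1 : ∀ j, ∫ r in Ioc 0 R, r * normSqAt (u j) r ≤ 1 := by
    intro j
    rw [← hN j]
    refine setIntegral_mono_set (hu j).integrableOn_normSqAt ?_ Ioc_subset_Ioi_self.eventuallyLE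
    filter_upwards [ae_restrict_mem measurableSet_Ioi] with s hs
    exact mul_nonneg (le_of_lt hs) (normSqAt_nonneg _ s)
  obtain ⟨B₀, hB₀⟩ := hE.bddAbove_range
  have hE0 : ∀ j, E j ≤ B₀ := fun j => hB₀ ⟨j, rfl⟩
  have hQ : ∀ j, ∀ δ : ℝ, 0 < δ → _ := fun j δ hδ =>
    (hbound (u j) (hu j)).trans (integral_inner_Lmn_le (hu j) hf ha μ hδ)
  simp only [hN] at hQ
  have hG : ∀ j, ∫ s in Ioi (0:ℝ), s * gradSqAt (u j) s
      ≤ 4 * (μ + 1 + B₀ - l + K + 4 * K ^ 2) := by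
    intro j
    have q1 := hQ j 1 one_pos
    have q2 := (hu j).trace_le hR (by positivity : 0 < 1 / (4 * K))
    rw [hN j] at q2
    have q3 := mul_le_mul_of_nonneg_left q2 hK.le
    have q4 : K * (1 / (4 * K) * (∫ s in Ioi (0:ℝ), s * gradSqAt (u j) s) + (1 / (4 * K))⁻¹ * 1)
        = 1 / 4 * (∫ s in Ioi (0:ℝ), s * gradSqAt (u j) s) + 4 * K ^ 2 := by field_simp
    have q5 := mul_le_mul_of_nonneg_left (hT1 j) hK.le
    have q6 := hE0 j
    simp only [hEdef] at q6
    linarith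
  set B : ℝ := 4 * (μ + 1 + B₀ - l + K + 4 * K ^ 2) with hB
  have hpt : ∀ r, 0 < r → Tendsto (fun j => r * normSqAt (u j) r) atTop (nhds 0) := by
    intro r hr
    have : Tendsto (fun j => r * ∑ k, u j r k ^ 2) atTop
        (nhds (r * ∑ _k : Fin 4, (0:ℝ) ^ 2)) :=
      (tendsto_finsetSum _ fun k _ =>
        (tendsto_zero_of_orthonormal hu horth hG hr k).pow 2).const_mul r
    simpa [normSqAt] using this
  have hT : Tendsto (fun j => ∫ r in Ioc 0 R, r * normSqAt (u j) r) atTop (nhds 0) := by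
    have := tendsto_integral_of_dominated_convergence (μ := volume.restrict (Ioc 0 R))
      (F := fun j r => r * normSqAt (u j) r) (f := fun _ => 0) (fun _ => B + 1)
      (fun j => (continuous_id.mul (hu j).continuous_normSqAt).aestronglyMeasurable)
      (by simp)
      (fun j => by
        filter_upwards [ae_restrict_mem measurableSet_Ioc] with s hs
        have e := (hu j).trace_le hs.1 one_pos
        rw [hN j, one_mul, inv_one, one_mul] at e
        rw [Real.norm_eq_abs, abs_of_nonneg (mul_nonneg hs.1.le (normSqAt_nonneg _ s))]
        linarith [hG j])
      (by
        filter_upwards [ae_restrict_mem measurableSet_Ioc] with s hs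
        exact hpt s hs.1)
    simpa using this
  have hlim1 : Tendsto (fun j => l - K * ((∫ r in Ioc 0 R, r * normSqAt (u j) r)
      + R * normSqAt (u j) R)) atTop (nhds (l - K * (0 + 0))) :=
    ((hT.add (hpt R hR)).const_mul K).const_sub l
  have hlim2 : Tendsto (fun j => (μ + ε) + ε⁻¹ * E j) atTop (nhds ((μ + ε) + ε⁻¹ * 0)) :=
    (hE.const_mul _).const_add _
  have hfinal := le_of_tendsto_of_tendsto' hlim1 hlim2 fun j => by
    have q := hQ j ε hε
    have g : 0 ≤ ∫ s in Ioi (0:ℝ), s * gradSqAt (u j) s :=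
      setIntegral_nonneg measurableSet_Ioi fun s hs =>
        mul_nonneg (le_of_lt hs) (gradSqAt_nonneg _ s)
    simp only [hEdef]
    linarith
  simp only [hl] at hfinal
  linarith

end LowerBound

section UpperBound

lemma integral_wave_residual_le {φ c c1 : ℝ → ℝ} {κ l : ℝ} (hφ : ContDiff ℝ (⊤ : ℕ∞) φ)
    (hφc : HasCompactSupport φ) (hc : ∀ t, HasDerivAt c (c1 t) t)
    (hc1 : ∀ t, HasDerivAt c1 (-(κ ^ 2 * c t)) t) (hcb : ∀ t, c t ^ 2 ≤ 1)
    (hc1b : ∀ t, c1 t ^ 2 ≤ κ ^ 2) (hl : 0 < l) :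
    ∫ t, (deriv (deriv fun t => φ (t / l) * c t) t + κ ^ 2 * (φ (t / l) * c t)) ^ 2
      ≤ l * (2 / l ^ 4 * (∫ t, deriv (deriv φ) t ^ 2)
        + 8 * κ ^ 2 / l ^ 2 * ∫ t, deriv φ t ^ 2) := by
  have hφ1 : ContDiff ℝ (⊤ : ℕ∞) (deriv φ) := (contDiff_infty_iff_deriv.1 hφ).2
  have hφ2 : Continuous (deriv (deriv φ)) := (contDiff_infty_iff_deriv.1 hφ1).2.continuous
  have d0 : ∀ t, HasDerivAt (fun t => φ (t / l)) (deriv φ (t / l) / l) t := fun t => by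
    have := ((hφ.differentiable (by simp) (t / l)).hasDerivAt).comp t
      ((hasDerivAt_id t).div_const l)
    exact this.congr_deriv (by simp; ring)
  have d1 : ∀ t, HasDerivAt (fun t => deriv φ (t / l)) (deriv (deriv φ) (t / l) / l) t :=
    fun t => by
    have := ((hφ1.differentiable (by simp) (t / l)).hasDerivAt).comp t
      ((hasDerivAt_id t).div_const l)
    exact this.congr_deriv (by simp; ring)
  have e1 : deriv (fun t => φ (t / l) * c t)
      = fun t => deriv φ (t / l) / l * c t + φ (t / l) * c1 t :=
    funext fun t => ((d0 t).mul (hc t)).deriv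
  have e2 : ∀ t, deriv (deriv fun t => φ (t / l) * c t) t + κ ^ 2 * (φ (t / l) * c t)
      = deriv (deriv φ) (t / l) / l ^ 2 * c t + 2 * (deriv φ (t / l) / l * c1 t) := by
    intro t
    have h : HasDerivAt (fun t => deriv φ (t / l) / l * c t + φ (t / l) * c1 t)
        ((deriv (deriv φ) (t / l) / l / l * c t + deriv φ (t / l) / l * c1 t)
          + (deriv φ (t / l) / l * c1 t + φ (t / l) * -(κ ^ 2 * c t))) t :=
      (((d1 t).div_const l).mul (hc t)).add ((d0 t).mul (hc1 t))
    rw [e1, h.deriv]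
    field_simp
    ring
  have i2 : Integrable fun t => deriv (deriv φ) t ^ 2 :=
    Continuous.integrable_of_hasCompactSupport (f := fun t => deriv (deriv φ) t ^ 2)
      (by fun_prop) (hφc.deriv.deriv.comp_left (g := fun x : ℝ => x ^ 2) (by simp))
  have i1 : Integrable fun t => deriv φ t ^ 2 :=
    Continuous.integrable_of_hasCompactSupport (f := fun t => deriv φ t ^ 2)
      (hφ1.continuous.pow 2) (hφc.deriv.comp_left (g := fun x : ℝ => x ^ 2) (by simp))
  obtain ⟨H, hH⟩ : ∃ H : ℝ → ℝ, H = fun t => 2 / l ^ 4 * deriv (deriv φ) t ^ 2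
      + 8 * κ ^ 2 / l ^ 2 * deriv φ t ^ 2 := ⟨_, rfl⟩
  have iH : Integrable H := by
    rw [hH]
    exact (i2.const_mul (2 / l ^ 4)).add (i1.const_mul (8 * κ ^ 2 / l ^ 2))
  calc _ ≤ ∫ t, H (t / l) := by
        refine integral_mono_of_nonneg (ae_of_all _ fun t => sq_nonneg _) (iH.comp_div hl.ne')
          (ae_of_all _ fun t => ?_)
        simp only [e2, hH]
        set x := deriv (deriv φ) (t / l)
        set y := deriv φ (t / l)
        have h1 : (x / l ^ 2 * c t + 2 * (y / l * c1 t)) ^ 2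
            ≤ 2 * (x ^ 2 / l ^ 4 * c t ^ 2) + 8 * (y ^ 2 / l ^ 2 * c1 t ^ 2) := by
          have := sq_nonneg (x / l ^ 2 * c t - 2 * (y / l * c1 t))
          have e3 : x ^ 2 / l ^ 4 * c t ^ 2 = (x / l ^ 2 * c t) ^ 2 := by ring
          have e4 : y ^ 2 / l ^ 2 * c1 t ^ 2 = (y / l * c1 t) ^ 2 := by ring
          rw [e3, e4]
          linarith
        have h2 := mul_le_mul_of_nonneg_left (hcb t) (by positivity : 0 ≤ x ^ 2 / l ^ 4)
        have h3 := mul_le_mul_of_nonneg_left (hc1b t) (by positivity : 0 ≤ y ^ 2 / l ^ 2)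
        have e5 : 2 / l ^ 4 * x ^ 2 + 8 * κ ^ 2 / l ^ 2 * y ^ 2
            = 2 * (x ^ 2 / l ^ 4 * 1) + 8 * (y ^ 2 / l ^ 2 * κ ^ 2) := by ring
        rw [e5]
        linarith
    _ = _ := by
        rw [Measure.integral_comp_div H l, hH, integral_add (i2.const_mul _) (i1.const_mul _), integral_const_mul,
          integral_const_mul, abs_of_pos hl, smul_eq_mul]

/-- Compactly supported approximate solutions of `g'' + κ² g = 0` on the line. -/
lemma exists_approximate_wave (κ : ℝ) {ε : ℝ} (hε : 0 < ε) :
    ∃ g : ℝ → ℝ, ContDiff ℝ (⊤ : ℕ∞) g ∧ HasCompactSupport g ∧ 0 < ∫ t, g t ^ 2 ∧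
      ∫ t, (deriv (deriv g) t + κ ^ 2 * g t) ^ 2 ≤ ε * ∫ t, g t ^ 2 := by
  let b : ContDiffBump (0:ℝ) := default
  obtain ⟨φ, hφe⟩ : ∃ φ : ℝ → ℝ, φ = b := ⟨_, rfl⟩
  have hφ : ContDiff ℝ (⊤ : ℕ∞) φ := hφe ▸ b.contDiff
  have hφc : HasCompactSupport φ := hφe ▸ b.hasCompactSupport
  have hφ0 : φ 0 = 1 := hφe ▸ b.one_of_mem_closedBall (by simp [b.rIn_pos.le])
  set A : ℝ := ∫ t, φ t ^ 2 with hA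
  set B : ℝ := ∫ t, deriv (deriv φ) t ^ 2 with hB
  set D : ℝ := ∫ t, deriv φ t ^ 2 with hD
  have hB0 : 0 ≤ B := integral_nonneg fun t => sq_nonneg _
  have hD0 : 0 ≤ D := integral_nonneg fun t => sq_nonneg _
  have hA0 : 0 < A :=
    (hφ.continuous.pow 2).integral_pos_of_hasCompactSupport_nonneg_nonzero
      (hφc.comp_left (g := fun x : ℝ => x ^ 2) (by simp)) (fun t => sq_nonneg _)
      (x := 0) (by simp [hφ0])
  set l : ℝ := 1 + 2 * (2 * B + 8 * κ ^ 2 * D) / (ε * A) with hl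
  have hl1 : 1 ≤ l := by
    have : 0 ≤ 2 * (2 * B + 8 * κ ^ 2 * D) / (ε * A) := by positivity
    linarith
  have hl0 : 0 < l := by linarith
  have hbound : l * (2 / l ^ 4 * B + 8 * κ ^ 2 / l ^ 2 * D) ≤ ε * (l * A / 2) := by
    have h1 : 2 * (2 * B + 8 * κ ^ 2 * D) ≤ l * (ε * A) := by
      rw [hl, add_mul, div_mul_cancel₀ _ (by positivity)]
      have : 0 < 1 * (ε * A) := by positivity
      linarith
    have h2 : 2 / l ^ 4 * B ≤ 2 / l * B := by
      gcongr
      exact le_self_pow₀ hl1 (by norm_num)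
    have h3 : 8 * κ ^ 2 / l ^ 2 * D ≤ 8 * κ ^ 2 / l * D := by
      gcongr
      exact le_self_pow₀ hl1 (by norm_num)
    calc l * (2 / l ^ 4 * B + 8 * κ ^ 2 / l ^ 2 * D)
        ≤ l * (2 / l * B + 8 * κ ^ 2 / l * D) := by gcongr
      _ = 2 * B + 8 * κ ^ 2 * D := by field_simp
      _ ≤ _ := by linarith
  have hInt : ∀ c : ℝ → ℝ, Continuous c → HasCompactSupport (fun t => φ (t / l) * c t) ∧
      Integrable fun t => (φ (t / l) * c t) ^ 2 := by
    intro c hc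
    have hcs : HasCompactSupport (fun t => φ (t / l)) := by
      have := hφc.comp_homeomorph (Homeomorph.mulRight₀ l⁻¹ (by positivity))
      simpa [Function.comp_def, div_eq_mul_inv] using this
    have := hφ.continuous
    refine ⟨hcs.mul_right, Continuous.integrable_of_hasCompactSupport (by fun_prop) ?_⟩
    exact hcs.mul_right.comp_left (g := fun x : ℝ => x ^ 2) (by simp)
  have kc : Continuous fun t => Real.cos (κ * t) := by fun_prop
  have ks : Continuous fun t => Real.sin (κ * t) := by fun_prop
  have hsum : (∫ t, (φ (t / l) * Real.cos (κ * t)) ^ 2)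
      + (∫ t, (φ (t / l) * Real.sin (κ * t)) ^ 2) = l * A := by
    rw [← integral_add (hInt _ kc).2 (hInt _ ks).2]
    have e : ∀ t, (φ (t / l) * Real.cos (κ * t)) ^ 2 + (φ (t / l) * Real.sin (κ * t)) ^ 2
        = (fun t => φ t ^ 2) (t / l) := by
      intro t
      rw [mul_pow, mul_pow, ← mul_add, Real.cos_sq_add_sin_sq, mul_one]
    simp only [e]
    rw [Measure.integral_comp_div (fun t => φ t ^ 2) l, abs_of_pos hl0, smul_eq_mul]
  have dk : ∀ t : ℝ, HasDerivAt (fun t => κ * t) κ t := fun t => by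
    simpa using (hasDerivAt_id t).const_mul κ
  have dc : ∀ t, HasDerivAt (fun t => Real.cos (κ * t)) (-κ * Real.sin (κ * t)) t := fun t =>
    (dk t).cos.congr_deriv (by ring)
  have ds : ∀ t, HasDerivAt (fun t => Real.sin (κ * t)) (κ * Real.cos (κ * t)) t := fun t =>
    (dk t).sin.congr_deriv (by ring)
  have main : ∀ c c1 : ℝ → ℝ, ContDiff ℝ (⊤ : ℕ∞) c → (∀ t, HasDerivAt c (c1 t) t) →
      (∀ t, HasDerivAt c1 (-(κ ^ 2 * c t)) t) → (∀ t, c t ^ 2 ≤ 1) →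
      (∀ t, c1 t ^ 2 ≤ κ ^ 2) → l * A / 2 ≤ ∫ t, (φ (t / l) * c t) ^ 2 →
      ∃ g : ℝ → ℝ, ContDiff ℝ (⊤ : ℕ∞) g ∧ HasCompactSupport g ∧ 0 < ∫ t, g t ^ 2 ∧
        ∫ t, (deriv (deriv g) t + κ ^ 2 * g t) ^ 2 ≤ ε * ∫ t, g t ^ 2 := by
    intro c c1 h1 h2 h3 h4 h5 h6
    refine ⟨fun t => φ (t / l) * c t, (hφ.comp (contDiff_id.div_const l)).mul h1,
      (hInt c h1.continuous).1, lt_of_lt_of_le (by positivity) h6, ?_⟩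
    refine (integral_wave_residual_le hφ hφc h2 h3 h4 h5 hl0).trans (hbound.trans ?_)
    exact mul_le_mul_of_nonneg_left h6 hε.le
  have hκ : ∀ x : ℝ, x ^ 2 ≤ 1 → (κ * x) ^ 2 ≤ κ ^ 2 := fun x hx => by
    rw [mul_pow]; exact mul_le_of_le_one_right (sq_nonneg _) hx
  by_cases hcase : l * A / 2 ≤ ∫ t, (φ (t / l) * Real.cos (κ * t)) ^ 2
  · refine main (fun t => Real.cos (κ * t)) _ (Real.contDiff_cos.comp (contDiff_const.mul contDiff_id)) dc
      (fun t => ((ds t).const_mul (-κ)).congr_deriv (by simp; ring))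
      (fun t => Real.cos_sq_le_one _) (fun t => ?_) hcase
    rw [neg_mul, neg_sq]
    exact hκ _ (Real.sin_sq_le_one _)
  · refine main (fun t => Real.sin (κ * t)) _ (Real.contDiff_sin.comp (contDiff_const.mul contDiff_id)) ds
      (fun t => ((dc t).const_mul κ).congr_deriv (by simp; ring))
      (fun t => Real.sin_sq_le_one _) (fun t => hκ _ (Real.cos_sq_le_one _)) ?_
    linarith [not_le.1 hcase]

variable {n m : ℤ} {lam : ℝ} {f a : ℝ → ℝ}

lemma Lmn_single (p : Fin 4) (h : ℝ → ℝ) (r : ℝ) (k : Fin 4) :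
    Lmn n m lam f a (fun s => Pi.single p (h s)) r k
      = (if k = p then -(deriv (deriv h) r) - deriv h r / r else 0)
        + Vmn n m lam f a r k p * h r := by
  have e : ∑ j, Vmn n m lam f a r k j * (Pi.single p (h r) : Fin 4 → ℝ) j
      = Vmn n m lam f a r k p * h r := by
    simp [Pi.single_apply]
  rw [Lmn, e]
  by_cases hk : k = p
  · subst hk; simp
  · simp [hk]

lemma sum_Lmn_single_sub_sq_le (p : Fin 4) (h : ℝ → ℝ) (r κ μ : ℝ) (d : Fin 4 → ℝ)
    (hμ : μ = d p + κ ^ 2) :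
    ∑ k, (Lmn n m lam f a (fun s => Pi.single p (h s)) r k
        - μ * (Pi.single p (h r) : Fin 4 → ℝ) k) ^ 2
      ≤ 3 * ((deriv (deriv h) r + κ ^ 2 * h r) ^ 2 + (1 / r) ^ 2 * deriv h r ^ 2
        + (∑ k, (Vmn n m lam f a r k p - Matrix.diagonal d k p) ^ 2) * h r ^ 2) := by
  have key : ∀ k, (Lmn n m lam f a (fun s => Pi.single p (h s)) r k
        - μ * (Pi.single p (h r) : Fin 4 → ℝ) k) ^ 2
      ≤ 3 * ((if k = p then (deriv (deriv h) r + κ ^ 2 * h r) ^ 2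
          + (1 / r) ^ 2 * deriv h r ^ 2 else 0)
        + (Vmn n m lam f a r k p - Matrix.diagonal d k p) ^ 2 * h r ^ 2) := by
    intro k
    rw [Lmn_single]
    by_cases hk : k = p
    · subst hk
      simp only [if_true, Pi.single_eq_same, Matrix.diagonal_apply_eq, hμ]
      have key : ∀ x y z : ℝ, (-x - y + z) ^ 2 ≤ 3 * (x ^ 2 + y ^ 2 + z ^ 2) := fun x y z => by
        nlinarith [sq_nonneg (x - y), sq_nonneg (x + z), sq_nonneg (y + z)]
      have h := key (deriv (deriv h) r + κ ^ 2 * h r) (1 / r * deriv h r)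
        ((Vmn n m lam f a r k k - d k) * h r)
      refine le_trans (le_of_eq ?_) (h.trans (le_of_eq ?_)) <;> ring
    · simp only [hk, if_false, Pi.single_eq_of_ne hk, Matrix.diagonal_apply_ne _ hk]
      nlinarith [sq_nonneg (Vmn n m lam f a r k p * h r)]
  refine (Finset.sum_le_sum fun k _ => key k).trans (le_of_eq ?_)
  rw [← Finset.mul_sum, Finset.sum_add_distrib, Finset.sum_ite_eq', Finset.sum_mul]
  simp

lemma exists_test_function (hV : Tendsto (fun r => Vmn n m lam f a r) atTop
      (nhds (Matrix.diagonal ![lam, 1, 1, 1]))) {μ : ℝ} (hμ : min 1 lam ≤ μ)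
    {ε : ℝ} (hε : 0 < ε) (R : ℝ) :
    ∃ u : ℝ → Fin 4 → ℝ, IsTest u ∧ tsupport u ⊆ Ioi R ∧
      (∫ r, (∑ k, u r k * u r k) ∂rmeasure) = 1 ∧
      ∫ r, (∑ k, (Lmn n m lam f a u r k - μ * u r k) ^ 2) ∂rmeasure ≤ ε := by
  obtain ⟨p, hp⟩ : ∃ p : Fin 4, (![lam, 1, 1, 1] : Fin 4 → ℝ) p = min 1 lam := by
    rcases le_total lam 1 with h | h
    · exact ⟨0, by simp [h]⟩
    · exact ⟨1, by simp [h]⟩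
  set d : Fin 4 → ℝ := ![lam, 1, 1, 1] with hd
  set κ : ℝ := √(μ - min 1 lam) with hκ
  have hκ2 : μ = d p + κ ^ 2 := by rw [hκ, Real.sq_sqrt (by linarith), hp]; ring
  obtain ⟨g, hg, hgc, hgpos, hgres⟩ := exists_approximate_wave κ (by positivity : 0 < ε / 18)
  have hg1 : ContDiff ℝ (⊤ : ℕ∞) (deriv g) := (contDiff_infty_iff_deriv.1 hg).2
  have hg2 : Continuous (deriv (deriv g)) := (contDiff_infty_iff_deriv.1 hg1).2.continuous
  set M : ℝ := ∫ t, g t ^ 2 with hM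
  set M1 : ℝ := ∫ t, deriv g t ^ 2 with hM1
  have hM10 : 0 ≤ M1 := integral_nonneg fun t => sq_nonneg _
  obtain ⟨ρ, hρ, hρe⟩ : ∃ ρ : ℝ, 0 < ρ ∧ ρ * (M1 + M) = ε / 18 * M :=
    ⟨ε / 18 * M / (M1 + M), by positivity, by field_simp⟩
  have hW : Tendsto (fun r => ∑ k, (Vmn n m lam f a r k p - Matrix.diagonal d k p) ^ 2) atTop
      (nhds 0) := by
    have h1 : ∀ k, Tendsto (fun r => Vmn n m lam f a r k p) atTop
        (nhds (Matrix.diagonal d k p)) := fun k =>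
      tendsto_pi_nhds.1 (tendsto_pi_nhds.1 hV k) p
    have := tendsto_finsetSum Finset.univ fun k _ =>
      ((h1 k).sub_const (Matrix.diagonal d k p)).pow 2
    simpa using this
  have hI : Tendsto (fun r : ℝ => (1 / r) ^ 2) atTop (nhds 0) := by
    have := (tendsto_inv_atTop_zero (𝕜 := ℝ)).pow 2
    simpa using this
  obtain ⟨R₀, hR₀⟩ := eventually_atTop.1
    ((hW.eventually_lt_const hρ).and (hI.eventually_lt_const hρ))
  obtain ⟨S, hS0, hS⟩ : ∃ S : ℝ, 0 < S ∧ ∀ t, t ∈ tsupport g → |t| ≤ S := by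
    obtain ⟨S, hS⟩ := hgc.isCompact.isBounded.subset_closedBall (0:ℝ)
    refine ⟨max S 1, by positivity, fun t ht => ?_⟩
    have := hS ht
    rw [mem_closedBall_zero_iff] at this
    exact this.trans (le_max_left _ _)
  set s : ℝ := max (2 * S) (max (R₀ + S) (R + S + 1)) with hs
  have hs1 : 2 * S ≤ s := le_max_left _ _
  have hs2 : R₀ + S ≤ s := (le_max_left _ _).trans (le_max_right _ _)
  have hs3 : R + S + 1 ≤ s := (le_max_right _ _).trans (le_max_right _ _)
  have hspos : 0 < s := by linarith
  have hsupp : ∀ r, r - s ∈ tsupport g → s - S ≤ r ∧ s / 2 ≤ r ∧ r ≤ 3 * s / 2 := by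
    intro r hr
    have := abs_le.1 (hS _ hr)
    refine ⟨by linarith, by linarith, by linarith⟩
  have i0 : ∀ {F : ℝ → ℝ}, Continuous F → (∀ t, t ∉ tsupport g → F t = 0) → Integrable F :=
    fun hF h0 => hF.integrable_of_hasCompactSupport
      (HasCompactSupport.intro hgc.isCompact fun t ht => h0 t ht)
  have z0 : ∀ t, t ∉ tsupport g → g t = 0 := fun t ht => image_eq_zero_of_notMem_tsupport ht
  have z1 : ∀ t, t ∉ tsupport g → deriv g t = 0 := fun t ht =>
    image_eq_zero_of_notMem_tsupport fun h => ht (tsupport_deriv_subset h)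
  have z2 : ∀ t, t ∉ tsupport g → deriv (deriv g) t = 0 := fun t ht =>
    image_eq_zero_of_notMem_tsupport fun h =>
      ht (tsupport_deriv_subset (tsupport_deriv_subset h))
  have c0 := hg.continuous
  have c1 := hg1.continuous
  set N : ℝ := ∫ r, r * g (r - s) ^ 2 with hN
  have hNle : s / 2 * M ≤ N := by
    rw [hM, ← integral_sub_right_eq_self (fun t => g t ^ 2) s, ← integral_const_mul]
    refine integral_mono
      (((i0 (c0.pow 2) fun t ht => by simp [z0 t ht]).comp_sub_right s).const_mul _) ?_
      fun r => ?_
    · have := (i0 (F := fun t => (t + s) * g t ^ 2) (by fun_prop)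
        fun t ht => by simp [z0 t ht]).comp_sub_right s
      simpa using this
    · by_cases hr : r - s ∈ tsupport g
      · exact mul_le_mul_of_nonneg_right (hsupp r hr).2.1 (sq_nonneg _)
      · simp [z0 _ hr]
  have hNpos : 0 < N := lt_of_lt_of_le (by positivity) hNle
  obtain ⟨β, hβ⟩ : ∃ β : ℝ, β ^ 2 * N = 1 := ⟨√(N⁻¹), by
    rw [Real.sq_sqrt (by positivity), inv_mul_cancel₀ hNpos.ne']⟩
  set h : ℝ → ℝ := fun r => β * g (r - s) with hh
  have hd1 : deriv h = fun r => β * deriv g (r - s) := by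
    funext r
    rw [hh, deriv_const_mul_field, deriv_comp_sub_const]
  have hd2 : deriv (deriv h) = fun r => β * deriv (deriv g) (r - s) := by
    funext r
    rw [hd1, deriv_const_mul_field, deriv_comp_sub_const]
  have hh0 : ∀ r, r ∉ Icc (s - S) (s + S) → h r = 0 := by
    intro r hr
    have : r - s ∉ tsupport g := fun hm => hr (by
      have := abs_le.1 (hS _ hm)
      exact ⟨by linarith, by linarith⟩)
    simp [hh, z0 _ this]
  have hts : tsupport (fun r => (Pi.single p (h r) : Fin 4 → ℝ)) ⊆ Icc (s - S) (s + S) :=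
    closure_minimal (fun r hr => by
      by_contra hc
      exact hr (by simp [hh0 r hc])) isClosed_Icc
  have hzero : ∀ {F : ℝ → ℝ}, (∀ r, r - s ∉ tsupport g → F r = 0) →
      ∫ r in Ioi (0:ℝ), F r = ∫ r, F r := fun hF =>
    setIntegral_eq_integral_of_forall_compl_eq_zero fun r hr => hF r fun hm => hr
      (lt_of_lt_of_le (by positivity) (hsupp r hm).2.1)
  refine ⟨fun r => Pi.single p (h r), ⟨?_, ?_, ?_⟩, ?_, ?_, ?_⟩
  · refine contDiff_pi.2 fun k => ?_
    by_cases hk : k = p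
    · subst hk
      simpa using contDiff_const.mul (hg.comp (contDiff_id.sub contDiff_const))
    · simpa [hk] using contDiff_const
  · exact HasCompactSupport.of_support_subset_isCompact isCompact_Icc
      (subset_closure.trans hts)
  · exact hts.trans fun r hr => lt_of_lt_of_le (by linarith) hr.1
  · exact hts.trans fun r hr => lt_of_lt_of_le (by linarith) hr.1
  · rw [integral_rmeasure]
    have e : ∀ r, r * ∑ k, (Pi.single p (h r) : Fin 4 → ℝ) k * (Pi.single p (h r) : Fin 4 → ℝ) k
        = β ^ 2 * (r * g (r - s) ^ 2) := by
      intro r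
      simp only [Pi.single_apply, ite_mul, mul_ite, mul_zero, zero_mul]
      simp [hh]
      ring
    simp only [e]
    rw [hzero fun r hr => by simp [z0 _ hr], integral_const_mul, hβ]
  · rw [integral_rmeasure]
    set G : ℝ → ℝ := fun t => (deriv (deriv g) t + κ ^ 2 * g t) ^ 2
      + ρ * (deriv g t ^ 2 + g t ^ 2) with hG
    have iG1 : Integrable fun t => (deriv (deriv g) t + κ ^ 2 * g t) ^ 2 :=
      i0 (by fun_prop) fun t ht => by simp [z0 t ht, z2 t ht]
    have iG2 : Integrable fun t => deriv g t ^ 2 :=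
      i0 (by fun_prop) fun t ht => by simp [z1 t ht]
    have iG3 : Integrable fun t => g t ^ 2 :=
      i0 (by fun_prop) fun t ht => by simp [z0 t ht]
    have iG : Integrable G := iG1.add ((iG2.add iG3).const_mul ρ)
    have hGi : ∫ t, G t ≤ ε / 9 * M := by
      have i23 : Integrable fun t => deriv g t ^ 2 + g t ^ 2 := iG2.add iG3
      rw [hG, integral_add iG1 (i23.const_mul ρ), integral_const_mul,
        integral_add iG2 iG3, hρe]
      linarith
    calc _ ≤ ∫ r in Ioi (0:ℝ), 9 * s / 2 * β ^ 2 * G (r - s) := by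
          refine integral_mono_of_nonneg ?_ ((iG.comp_sub_right s).const_mul _).integrableOn ?_
          · filter_upwards [ae_restrict_mem measurableSet_Ioi] with r hr
            exact mul_nonneg (le_of_lt hr) (Finset.sum_nonneg fun _ _ => sq_nonneg _)
          · filter_upwards [ae_restrict_mem measurableSet_Ioi] with r hr
            have b1 := sum_Lmn_single_sub_sq_le (n := n) (m := m) (lam := lam) (f := f) (a := a)
              p h r κ μ d hκ2
            have b2 : r * (3 * ((deriv (deriv h) r + κ ^ 2 * h r) ^ 2
                + (1 / r) ^ 2 * deriv h r ^ 2
                + (∑ k, (Vmn n m lam f a r k p - Matrix.diagonal d k p) ^ 2) * h r ^ 2))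
                ≤ 9 * s / 2 * β ^ 2 * G (r - s) := by
              by_cases hm : r - s ∈ tsupport g
              · obtain ⟨q1, -, q3⟩ := hsupp r hm
                obtain ⟨w1, w2⟩ := hR₀ r (by linarith)
                have e : 9 * s / 2 * β ^ 2 * G (r - s) = 3 * s / 2 * (3 * (
                    (deriv (deriv h) r + κ ^ 2 * h r) ^ 2 + ρ * deriv h r ^ 2
                    + ρ * h r ^ 2)) := by
                  rw [hd2, hd1]; simp only [hG, hh]; ring
                rw [e]
                gcongr
              · rw [hd2, hd1]
                simp [hh, hG, z0 _ hm, z1 _ hm, z2 _ hm]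
            exact (mul_le_mul_of_nonneg_left b1 (le_of_lt hr)).trans b2
      _ = 9 * s / 2 * β ^ 2 * ∫ t, G t := by
          rw [hzero fun r hr => by simp [hG, z0 _ hr, z1 _ hr, z2 _ hr], integral_const_mul,
            integral_sub_right_eq_self G s]
      _ ≤ 9 * s / 2 * β ^ 2 * (ε / 9 * M) := by gcongr
      _ = β ^ 2 * (s / 2 * M) * ε := by ring
      _ ≤ β ^ 2 * N * ε := by gcongr
      _ = ε := by rw [hβ, one_mul]

lemma mem_essSpecRad_of_min_le (hV : Tendsto (fun r => Vmn n m lam f a r) atTop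
      (nhds (Matrix.diagonal ![lam, 1, 1, 1]))) {μ : ℝ} (hμ : min 1 lam ≤ μ) :
    μ ∈ essSpecRad (Lmn n m lam f a) := by
  choose U hU hUR hU1 hUE using fun (j : ℕ) (R : ℝ) =>
    exists_test_function hV hμ (Nat.one_div_pos_of_nat (α := ℝ) (n := j)) R
  have hT : ∀ j R, ∃ T, R ≤ T ∧ tsupport (U j R) ⊆ Iic T := fun j R => by
    obtain ⟨T, hT⟩ := (hU j R).compact.isCompact.bddAbove
    exact ⟨max R T, le_max_left _ _, fun x hx => (hT hx).trans (le_max_right _ _)⟩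
  choose T hRT hT using hT
  let Q : ℕ → ℝ := fun j => Nat.rec 0 T j
  have hQ : Monotone Q := monotone_nat_of_le_succ fun j => hRT j (Q j)
  have hdisj : ∀ i j, i < j → ∀ r k, U i (Q i) r k * U j (Q j) r k = 0 := by
    intro i j hij r k
    by_cases hr : r ∈ tsupport (U i (Q i))
    · have h1 : r ≤ Q j := (hT i (Q i) hr).trans (hQ hij)
      rw [IsTest.zero (u := U j (Q j)) (fun h2 => absurd (hUR j (Q j) h2) (not_lt.2 h1)), mul_zero]
    · rw [IsTest.zero hr, zero_mul]
  refine ⟨fun j => U j (Q j), fun j => (hU j _).smooth, fun j => (hU j _).compact,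
    fun j => (hU j _).supp, fun i j => ?_, ?_⟩
  · rcases lt_trichotomy i j with h | rfl | h
    · simp [h.ne, hdisj i j h]
    · simpa using hU1 i (Q i)
    · simp [h.ne', mul_comm (U i (Q i) _ _), hdisj j i h]
  · exact squeeze_zero (fun j => integral_nonneg fun r => Finset.sum_nonneg fun _ _ => sq_nonneg _)
      (fun j => hUE j (Q j)) tendsto_one_div_add_atTop_nhds_zero_nat

end UpperBound

/-- as `r → ∞` the potential `V_m^{(n)}(r)` tends to `diag(λ, 1, 1, 1)`,
and consequently the essential spectrum of `L_m^{(n)} = -Δ_r·Id + V_m^{(n)}` on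
`L²((0,∞), r dr)⁴` equals `[min(1,λ), ∞)`. -/
theorem stmt19 (n m : ℤ) (lam : ℝ) (hlam : 0 < lam) (f a : ℝ → ℝ)
    (hf : ∀ r ∈ Ioi (0:ℝ), ContDiffAt ℝ (⊤ : ℕ∞) f r)
    (ha : ∀ r ∈ Ioi (0:ℝ), ContDiffAt ℝ (⊤ : ℕ∞) a r)
    (hfbdd : ∃ C : ℝ, ∀ r ∈ Ioi (0:ℝ), |f r| ≤ C)
    (hflim : Tendsto f atTop (nhds 1))
    (hdecay : ∃ C c : ℝ, 0 < c ∧ ∀ r : ℝ, 1 ≤ r →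
      |1 - a r| ≤ C * Real.exp (-c * r) ∧ |deriv f r| ≤ C * Real.exp (-c * r)) :
    Tendsto (fun r => Vmn n m lam f a r) atTop
      (nhds (Matrix.diagonal ![lam, 1, 1, 1])) ∧
    essSpecRad (Lmn n m lam f a) = Set.Ici (min 1 lam) := by
  obtain ⟨C, hC⟩ := hfbdd
  have hV := Vmn_tendsto n m lam hflim hdecay
  exact ⟨hV, Subset.antisymm (fun _ hμ => min_le_of_mem_essSpecRad hlam hf ha hC hV hμ)
    fun _ hμ => mem_essSpecRad_of_min_le hV hμ⟩
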